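/- arXiv:1308.3336 — 9 statements merged into one kernel-verified Lean document; each statement's English description precedes it below -/
import Mathlib

section
/- Assume GD = (V, binom(V,2), d_GD) is a μ-near metric space approximating a metric space (V, d̄). Let S ⊆ V be a nonempty terminal set, let α ≥ 1, and let T be a tree with S ⊆ V(T) ⊆ V such that d_GD(T) ≤ α · d_GD(MST(GD[S])), where MST(GD[S]) is a minimum-weight spanning tree of the complete graph GD restricted to S. Then d̄(T) ≤ 2αμ · d̄(T̄), where T̄ is a tree of minimum total d̄-weight among all trees on vertex subsets of V whose vertex set contains S (a minimum Steiner tree of S in the metric d̄). -/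
open SimpleGraph

/-- The total weight of the edges of a subgraph of the complete graph. -/
noncomputable def subWeight {V : Type*} (d : Sym2 V → ℝ)
    (H : (⊤ : SimpleGraph V).Subgraph) : ℝ :=
  ∑ᶠ e ∈ H.edgeSet, d e

/-- The metric `dist`, as a weight function on unordered pairs of vertices. -/
noncomputable def distE (V : Type*) [MetricSpace V] : Sym2 V → ℝ :=
  Sym2.lift ⟨fun a b => dist a b, fun a b => dist_comm a b⟩

/-- The length of the polygonal path visiting the points of a list in order. -/
def pathLength {V : Type*} [MetricSpace V] : List V → ℝ
  | [] => 0
  | [_] => 0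
  | a :: b :: l => dist a b + pathLength (b :: l)

section pathLength

variable {V : Type*} [MetricSpace V]

lemma pathLength_cons_cons (a b : V) (l : List V) :
    pathLength (a :: b :: l) = dist a b + pathLength (b :: l) := rfl

lemma pathLength_le_cons (a : V) (l : List V) : pathLength l ≤ pathLength (a :: l) := by
  cases l with
  | nil => simp [pathLength]
  | cons b l =>
    rw [pathLength_cons_cons]
    linarith [dist_nonneg (x := a) (y := b)]

lemma pathLength_cons_le (a b : V) (l : List V) :
    pathLength (a :: l) ≤ dist a b + pathLength (b :: l) := by
  cases l with
  | nil => simp [pathLength]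
  | cons c l =>
    rw [pathLength_cons_cons, pathLength_cons_cons]
    linarith [dist_triangle a b c]

lemma pathLength_cons_le_of_sublist {l l' : List V} (h : l'.Sublist l) (a : V) :
    pathLength (a :: l') ≤ pathLength (a :: l) := by
  induction h generalizing a with
  | slnil => exact le_rfl
  | @cons l' _ b _ ih =>
    rw [pathLength_cons_cons]
    linarith [pathLength_cons_le a b l', ih b]
  | cons_cons b _ ih =>
    rw [pathLength_cons_cons, pathLength_cons_cons]
    linarith [ih b]

lemma pathLength_le_of_sublist {l l' : List V} (h : l'.Sublist l) :
    pathLength l' ≤ pathLength l := by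
  cases h with
  | slnil => exact le_rfl
  | cons a h => exact (pathLength_le_cons a _).trans (pathLength_cons_le_of_sublist h a)
  | cons_cons a h => exact pathLength_cons_le_of_sublist h a

/-- A new point `v` can be inserted right after a point `u` of a path. -/
lemma exists_perm_pathLength_le (u v : V) (l : List V) (a : V) (hu : u ∈ a :: l) :
    ∃ l' : List V, l'.Perm (v :: l) ∧
      pathLength (a :: l') ≤ pathLength (a :: l) + 2 * dist u v := by
  induction l generalizing a with
  | nil =>
    obtain rfl : u = a := by simpa using hu
    refine ⟨[v], List.Perm.refl _, ?_⟩
    simp only [pathLength]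
    linarith [dist_nonneg (x := u) (y := v)]
  | cons b l ih =>
    rcases List.mem_cons.1 hu with rfl | hu
    · refine ⟨v :: b :: l, List.Perm.refl _, ?_⟩
      simp only [pathLength_cons_cons]
      linarith [dist_triangle v u b, dist_comm u v]
    · obtain ⟨l', hp, hl⟩ := ih b hu
      refine ⟨b :: l', (hp.cons b).trans (List.Perm.swap v b l), ?_⟩
      rw [pathLength_cons_cons, pathLength_cons_cons]
      linarith

end pathLength

section subWeight

variable {V : Type*} [Fintype V]

lemma subWeight_mono {d d' : Sym2 V → ℝ} (h : ∀ e, d e ≤ d' e)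
    (H : (⊤ : SimpleGraph V).Subgraph) : subWeight d H ≤ subWeight d' H := by
  classical
  unfold subWeight
  rw [finsum_mem_eq_toFinset_sum, finsum_mem_eq_toFinset_sum]
  exact Finset.sum_le_sum fun e _ => h e

lemma subWeight_const_mul (c : ℝ) (d : Sym2 V → ℝ) (H : (⊤ : SimpleGraph V).Subgraph) :
    subWeight (fun e => c * d e) H = c * subWeight d H := by
  classical
  unfold subWeight
  rw [finsum_mem_eq_toFinset_sum, finsum_mem_eq_toFinset_sum, Finset.mul_sum]

lemma sum_le_subWeight {d : Sym2 V → ℝ} (hd : ∀ e, 0 ≤ d e)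
    (H : (⊤ : SimpleGraph V).Subgraph) (F : Finset (Sym2 V)) (hF : ∀ e ∈ F, e ∈ H.edgeSet) :
    ∑ e ∈ F, d e ≤ subWeight d H := by
  classical
  unfold subWeight
  rw [finsum_mem_eq_toFinset_sum]
  exact Finset.sum_le_sum_of_subset_of_nonneg (fun e he => by simpa using hF e he)
    fun e _ _ => hd e

lemma subWeight_le_sum {d : Sym2 V → ℝ} (hd : ∀ e, 0 ≤ d e)
    (H : (⊤ : SimpleGraph V).Subgraph) (F : Finset (Sym2 V)) (hF : ∀ e ∈ H.edgeSet, e ∈ F) :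
    subWeight d H ≤ ∑ e ∈ F, d e := by
  classical
  unfold subWeight
  rw [finsum_mem_eq_toFinset_sum]
  exact Finset.sum_le_sum_of_subset_of_nonneg (fun e he => hF e (by simpa using he))
    fun e _ _ => hd e

end subWeight

lemma distE_nonneg {V : Type*} [MetricSpace V] (e : Sym2 V) : 0 ≤ distE V e := by
  induction e with
  | h a b => exact dist_nonneg

/-- Every connected subgraph of a complete graph contains a spanning tree. -/
lemma exists_isTree_of_connected {V : Type*} [Fintype V] {H : (⊤ : SimpleGraph V).Subgraph}
    (hc : H.Connected) :
    ∃ T : (⊤ : SimpleGraph V).Subgraph, T.coe.IsTree ∧ T.verts = H.verts ∧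
      T.edgeSet ⊆ H.edgeSet := by
  classical
  obtain ⟨G, hG, hGt⟩ := hc.coe.exists_isTree_le
  have hadj : ∀ {a b : V}, (∃ (ha : a ∈ H.verts) (hb : b ∈ H.verts), G.Adj ⟨a, ha⟩ ⟨b, hb⟩) →
      H.Adj a b := fun ⟨_, _, h⟩ => hG h
  let T : (⊤ : SimpleGraph V).Subgraph :=
    { verts := H.verts
      Adj := fun a b => ∃ (ha : a ∈ H.verts) (hb : b ∈ H.verts), G.Adj ⟨a, ha⟩ ⟨b, hb⟩
      adj_sub := fun h => (hadj h).adj_sub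
      edge_vert := fun h => h.1
      symm := ⟨fun _ _ ⟨ha, hb, h⟩ => ⟨hb, ha, h.symm⟩⟩ }
  have hT : T.coe = G := by
    ext a b
    exact ⟨fun ⟨_, _, h⟩ => h, fun h => ⟨a.2, b.2, h⟩⟩
  refine ⟨T, hT ▸ hGt, rfl, fun e => ?_⟩
  induction e with
  | h a b => exact hadj

section trees

variable {V : Type*} [MetricSpace V]

/-- The points of a path span a connected subgraph of at most the weight of the path. -/
lemma exists_connected_of_list (a : V) (l : List V) :
    ∃ H : (⊤ : SimpleGraph V).Subgraph, H.Connected ∧ H.verts = {x | x ∈ a :: l} ∧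
      ∃ F : Finset (Sym2 V), (∀ e ∈ H.edgeSet, e ∈ F) ∧
        ∑ e ∈ F, distE V e ≤ pathLength (a :: l) := by
  classical
  induction l generalizing a with
  | nil =>
    refine ⟨(⊤ : SimpleGraph V).singletonSubgraph a, Subgraph.singletonSubgraph_connected,
      by ext; simp, ∅, by simp, by simp [pathLength]⟩
  | cons b l ih =>
    obtain ⟨H, hc, hv, F, hF, hw⟩ := ih b
    by_cases hab : a = b
    · subst hab
      refine ⟨H, hc, by rw [hv]; ext; simp, F, hF, ?_⟩
      rw [pathLength_cons_cons]
      simpa using hw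
    · have hadj : (⊤ : SimpleGraph V).Adj a b := by simpa using hab
      refine ⟨(⊤ : SimpleGraph V).subgraphOfAdj hadj ⊔ H,
        Subgraph.connected_sup (Subgraph.subgraphOfAdj_connected hadj).preconnected
          hc.preconnected ⟨b, by simp [hv]⟩, ?_,
        insert s(a, b) F, ?_, ?_⟩
      · ext x
        simp only [Subgraph.verts_sup, subgraphOfAdj_verts, hv, Set.mem_union,
          Set.mem_insert_iff, Set.mem_singleton_iff, Set.mem_ofPred_eq, List.mem_cons]
        tauto
      · intro e he
        rw [Subgraph.edgeSet_sup, edgeSet_subgraphOfAdj] at he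
        rcases he with he | he
        · simp [Set.mem_singleton_iff.1 he]
        · simp [hF e he]
      · rw [pathLength_cons_cons]
        have h1 : ∑ e ∈ insert s(a, b) F, distE V e ≤ distE V s(a, b) + ∑ e ∈ F, distE V e := by
          by_cases h : s(a, b) ∈ F
          · rw [Finset.insert_eq_of_mem h]
            linarith [distE_nonneg s(a, b)]
          · rw [Finset.sum_insert h]
        have h2 : distE V s(a, b) = dist a b := rfl
        linarith

variable [Fintype V]

/-- The vertices of a connected subgraph can be ordered along a path of at most twice
the weight of the subgraph. -/
lemma exists_list_of_connected {H : (⊤ : SimpleGraph V).Subgraph} (hc : H.Connected)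
    (n : ℕ) (hn : n + 1 ≤ H.verts.ncard) :
    ∃ (a : V) (l : List V), (a :: l).Nodup ∧ l.length = n ∧ (∀ x ∈ a :: l, x ∈ H.verts) ∧
      ∃ F : Finset (Sym2 V), (∀ e ∈ F, e ∈ H.edgeSet ∧ ∀ x ∈ e, x ∈ a :: l) ∧
        pathLength (a :: l) ≤ 2 * ∑ e ∈ F, distE V e := by
  classical
  induction n with
  | zero =>
    obtain ⟨a, ha⟩ := hc.nonempty
    exact ⟨a, [], by simp, rfl, by simpa using ha, ∅, by simp, by simp [pathLength]⟩
  | succ n ih =>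
    obtain ⟨a, l, hnd, hlen, hl, F, hF, hw⟩ := ih (by omega)
    obtain ⟨y, hy, hyl⟩ : ∃ y ∈ H.verts, y ∉ a :: l := by
      by_contra! hcon
      have h1 : H.verts ⊆ ((a :: l).toFinset : Set V) := fun y hy => by
        rw [List.coe_toFinset]; exact hcon y hy
      have h2 := Set.ncard_le_ncard h1 (Set.toFinite _)
      rw [Set.ncard_coe_finset] at h2
      have h3 := List.toFinset_card_le (a :: l)
      simp only [List.length_cons] at h3
      omega
    obtain ⟨p⟩ := hc.coe.preconnected ⟨a, hl a (by simp)⟩ ⟨y, hy⟩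
    obtain ⟨⟨⟨u, v⟩, huv⟩, -, hu, hv⟩ :=
      p.exists_boundary_dart {x | (x : V) ∈ a :: l} (by simp) hyl
    replace huv : H.Adj u v := huv
    replace hu : (u : V) ∈ a :: l := hu
    replace hv : (v : V) ∉ a :: l := hv
    obtain ⟨l', hp, hl'⟩ := exists_perm_pathLength_le (u : V) v l a hu
    have hmem : ∀ x, x ∈ a :: l' ↔ x = v ∨ x ∈ a :: l := fun x => by
      simp only [List.mem_cons, hp.mem_iff]
      tauto
    have hnot : s((u : V), (v : V)) ∉ F := fun h => hv ((hF _ h).2 v (by simp))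
    have hp' : (a :: l').Perm (v :: a :: l) := (hp.cons a).trans (List.Perm.swap _ _ _)
    refine ⟨a, l', hp'.nodup_iff.2 (List.nodup_cons.2 ⟨hv, hnd⟩), by simp [hp.length_eq, hlen],
      ?_, insert s((u : V), (v : V)) F, ?_, ?_⟩
    · intro x hx
      rcases (hmem x).1 hx with rfl | hx
      · exact v.2
      · exact hl x hx
    · intro e he
      rcases Finset.mem_insert.1 he with rfl | he
      · refine ⟨huv, fun x hx => ?_⟩
        rcases Sym2.mem_iff.1 hx with rfl | rfl
        · exact (hmem _).2 (Or.inr hu)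
        · exact (hmem _).2 (Or.inl rfl)
      · exact ⟨(hF e he).1, fun x hx => (hmem x).2 (Or.inr ((hF e he).2 x hx))⟩
    · rw [Finset.sum_insert hnot]
      have h2 : distE V s((u : V), (v : V)) = dist (u : V) v := rfl
      linarith

/-- A connected subgraph containing `S` yields a spanning tree of `S` of at most twice
its weight. -/
lemma exists_isTree_subWeight_le {H : (⊤ : SimpleGraph V).Subgraph} (hc : H.Connected)
    {S : Set V} (hS : S.Nonempty) (hSH : S ⊆ H.verts) :
    ∃ T : (⊤ : SimpleGraph V).Subgraph, T.coe.IsTree ∧ T.verts = S ∧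
      subWeight (distE V) T ≤ 2 * subWeight (distE V) H := by
  classical
  have hpos : 0 < H.verts.ncard := (Set.ncard_pos (Set.toFinite _)).2 (hS.mono hSH)
  obtain ⟨a, l, hnd, hlen, hl, F, hF, hw⟩ :=
    exists_list_of_connected hc (H.verts.ncard - 1) (by omega)
  have hcover : ((a :: l).toFinset : Set V) = H.verts := by
    refine Set.eq_of_subset_of_ncard_le (fun x hx => hl x (by simpa using hx)) ?_
      (Set.toFinite _)
    rw [Set.ncard_coe_finset, List.toFinset_card_of_nodup hnd, List.length_cons]
    omega
  have hmem : ∀ x, x ∈ (a :: l).filter (· ∈ S) ↔ x ∈ S := fun x => by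
    simp only [List.mem_filter, decide_eq_true_eq, and_iff_right_iff_imp]
    intro hx
    have h := hSH hx
    rw [← hcover] at h
    simpa using h
  have hsub : pathLength ((a :: l).filter (· ∈ S)) ≤ pathLength (a :: l) :=
    pathLength_le_of_sublist List.filter_sublist
  obtain ⟨s, hs⟩ := hS
  generalize (a :: l).filter (· ∈ S) = m at hmem hsub
  cases m with
  | nil => exact absurd ((hmem s).2 hs) (by simp)
  | cons b m =>
    obtain ⟨K, hK, hKv, E, hE, hEw⟩ := exists_connected_of_list b m
    obtain ⟨T, hT, hTv, hTK⟩ := exists_isTree_of_connected hK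
    refine ⟨T, hT, by rw [hTv, hKv]; ext x; exact hmem x, ?_⟩
    have h1 := subWeight_le_sum distE_nonneg T E fun e he => hE e (hTK he)
    have h2 := sum_le_subWeight distE_nonneg H F fun e he => (hF e he).1
    linarith

end trees

/-- Assume `GD` (complete graph with weights `d`) is a `μ`-near metric space
approximating the metric `dist` on `V`.  Let `S ⊆ V` be a nonempty terminal set,
`α ≥ 1`, and let `T` be a tree spanning a superset of `S` with
`d(T) ≤ α · d(MST(GD[S]))`, where `TM = MST(GD[S])` is a minimum-weight spanning
tree of the complete graph `GD` restricted to `S`.  Then `dist(T) ≤ 2αμ · dist(T̄)`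
where `T̄ = Tb` is a minimum Steiner tree of `S` in the metric `dist`, i.e. a tree of
minimum total `dist`-weight among all trees whose vertex set contains `S`. -/
theorem stmt2 {V : Type*} [Fintype V] [MetricSpace V]
    (μ α : ℝ) (hμ : 1 ≤ μ) (hα : 1 ≤ α)
    (d : Sym2 V → ℝ)
    (hlb : ∀ u v : V, dist u v ≤ d s(u, v))
    (hub : ∀ u v : V, d s(u, v) ≤ μ * dist u v)
    (S : Set V) (hS : S.Nonempty)
    (T : (⊤ : SimpleGraph V).Subgraph) (hT : T.coe.IsTree) (hTS : S ⊆ T.verts)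
    (TM : (⊤ : SimpleGraph V).Subgraph) (hTM : TM.coe.IsTree) (hTMv : TM.verts = S)
    (hTMmin : ∀ T' : (⊤ : SimpleGraph V).Subgraph, T'.coe.IsTree → T'.verts = S →
      subWeight d TM ≤ subWeight d T')
    (hTα : subWeight d T ≤ α * subWeight d TM)
    (Tb : (⊤ : SimpleGraph V).Subgraph) (hTb : Tb.coe.IsTree) (hTbS : S ⊆ Tb.verts)
    (hTbmin : ∀ T' : (⊤ : SimpleGraph V).Subgraph, T'.coe.IsTree → S ⊆ T'.verts →
      subWeight (distE V) Tb ≤ subWeight (distE V) T') :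
    subWeight (distE V) T ≤ 2 * α * μ * subWeight (distE V) Tb := by
  obtain ⟨T', hT', hT'v, hw⟩ := exists_isTree_subWeight_le ⟨hTb.connected⟩ hS hTbS
  have h1 : subWeight (distE V) T ≤ subWeight d T :=
    subWeight_mono (fun e => by induction e with | h a b => exact hlb a b) T
  have h2 : subWeight d T' ≤ μ * subWeight (distE V) T' := by
    rw [← subWeight_const_mul]
    exact subWeight_mono (fun e => by induction e with | h a b => exact hub a b) T'
  calc subWeight (distE V) T ≤ α * subWeight d TM := h1.trans hTα
    _ ≤ α * (μ * (2 * subWeight (distE V) Tb)) := by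
        have h3 := hTMmin T' hT' hT'v
        gcongr
        exact h3.trans (h2.trans (by gcongr))
    _ = 2 * α * μ * subWeight (distE V) Tb := by ring
end

section
/- Consider a set of terminals S = {t_1, t_2, …, t_n} (n ≥ 2) in a μ-near metric space GD = (V, binom(V,2), d_GD). For each 2 ≤ k ≤ n, let f_k be a minimum-d_GD-cost edge connecting t_k with {t_1, t_2, …, t_{k-1}}. Then ∏_{k=2}^{n} d_GD(f_k) ≤ (4μ)^{n-1} · ∏_{e ∈ E(MST(GD[S]))} d_GD(e), where MST(GD[S]) is a minimum-weight spanning tree of the complete graph GD restricted to S. -/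
open SimpleGraph

section
open scoped Classical

theorem exists_eq_of_mem_edges_of_isPath {α : Type*} {G : SimpleGraph α} {m s : α}
    (p : G.Walk m s) (hp : p.IsPath) {e : Sym2 α} (he : e ∈ p.edges) :
    ∃ u v, e = s(u, v) ∧ G.Adj u v ∧ (G.deleteEdges {e}).Reachable m u ∧
      (G.deleteEdges {e}).Reachable s v := by
  induction p with
  | nil => simp at he
  | @cons a b c h q ih =>
    rw [Walk.cons_isPath_iff] at hp
    have hne : s(a, b) ∉ q.edges := fun h' => hp.2 (q.fst_mem_support_of_mem_edges h')
    rw [Walk.edges_cons, List.mem_cons] at he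
    rcases he with rfl | he
    · refine ⟨a, b, rfl, h, .refl _, Reachable.symm ⟨q.toDeleteEdge _ hne⟩⟩
    · obtain ⟨u, v, huv, hadj, h1, h2⟩ := ih hp.1 he
      refine ⟨u, v, huv, hadj, Reachable.trans (Adj.reachable ?_) h1, h2⟩
      rw [deleteEdges_adj]
      exact ⟨h, fun h' => hne (by rw [Set.mem_singleton_iff.1 h']; exact he)⟩

theorem not_reachable_deleteEdges_of_isAcyclic {α : Type*} {G : SimpleGraph α}
    (hG : G.IsAcyclic) {m s u v : α} (hadj : G.Adj u v)
    (hu : (G.deleteEdges {s(u, v)}).Reachable m u)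
    (hv : (G.deleteEdges {s(u, v)}).Reachable s v) :
    ¬ (G.deleteEdges {s(u, v)}).Reachable m s := fun h =>
  isBridge_iff.1 (isAcyclic_iff_forall_adj_isBridge.1 hG hadj) ((hu.symm.trans h).trans hv)

theorem reachable_iff_deleteEdges_or {α : Type*} {G : SimpleGraph α} {m s u v : α}
    (hadj : G.Adj u v)
    (hu : (G.deleteEdges {s(u, v)}).Reachable m u)
    (hv : (G.deleteEdges {s(u, v)}).Reachable s v) (x : α) :
    G.Reachable m x ↔ (G.deleteEdges {s(u, v)}).Reachable m x ∨
      (G.deleteEdges {s(u, v)}).Reachable s x := by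
  have hle : G.deleteEdges {s(u, v)} ≤ G := deleteEdges_le _
  constructor
  · intro h
    rw [reachable_iff_reflTransGen] at h
    induction h with
    | refl => exact .inl (.refl _)
    | @tail y z _ hyz ih =>
      by_cases hE : s(y, z) = s(u, v)
      · rcases Sym2.eq_iff.1 hE with ⟨rfl, rfl⟩ | ⟨rfl, rfl⟩
        · exact .inr hv
        · exact .inl hu
      · have : (G.deleteEdges {s(u, v)}).Adj y z := by
          rw [deleteEdges_adj]; exact ⟨hyz, hE⟩
        exact ih.imp (·.trans this.reachable) (·.trans this.reachable)
  · rintro (h | h)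
    · exact h.mono hle
    · exact ((hu.mono hle).trans hadj.reachable).trans ((hv.mono hle).symm.trans (h.mono hle))

/-- The vertices reachable from `m`. -/
noncomputable def reachableFinset {α : Type*} [Fintype α] (G : SimpleGraph α) (m : α) :
    Finset α := {x | G.Reachable m x}

/-- The edges all of whose endpoints are reachable from `m`. -/
noncomputable def reachableEdges {α : Type*} [Fintype α] (G : SimpleGraph α) (m : α) :
    Finset (Sym2 α) := {e | e ∈ G.edgeSet ∧ ∀ x ∈ e, G.Reachable m x}

@[simp]
theorem mem_reachableFinset {α : Type*} [Fintype α] {G : SimpleGraph α} {m x : α} :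
    x ∈ reachableFinset G m ↔ G.Reachable m x := by simp [reachableFinset]

theorem mem_reachableEdges {α : Type*} [Fintype α] {G : SimpleGraph α} {m : α} {e : Sym2 α} :
    e ∈ reachableEdges G m ↔ e ∈ G.edgeSet ∧ ∀ x ∈ e, G.Reachable m x := by
  simp [reachableEdges]

theorem mk_mem_reachableEdges {α : Type*} [Fintype α] {G : SimpleGraph α} {m x y : α} :
    s(x, y) ∈ reachableEdges G m ↔ G.Adj x y ∧ G.Reachable m x := by
  rw [mem_reachableEdges]
  simp only [mem_edgeSet, Sym2.mem_iff, forall_eq_or_imp, forall_eq]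
  exact ⟨fun h => ⟨h.1, h.2.1⟩, fun h => ⟨h.1, h.2, h.2.trans h.1.reachable⟩⟩

theorem card_reachableFinset_lt {α : Type*} [Fintype α] {G : SimpleGraph α} {m u v u' v' : α}
    (hadj : G.Adj u v) (hu : (G.deleteEdges {s(u, v)}).Reachable m u)
    (hv : ¬ (G.deleteEdges {s(u, v)}).Reachable m v) (hne : s(u, v) ≠ s(u', v'))
    (hu' : ¬ (G.deleteEdges {s(u, v)}).Reachable m u')
    (hv' : ¬ (G.deleteEdges {s(u, v)}).Reachable m v') :
    (reachableFinset (G.deleteEdges {s(u, v)}) m).card <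
      (reachableFinset (G.deleteEdges {s(u', v')}) m).card := by
  have key : ∀ x, (G.deleteEdges {s(u, v)}).Reachable m x →
      (G.deleteEdges {s(u', v')}).Reachable m x := by
    intro x h
    rw [reachable_iff_reflTransGen] at h
    induction h with
    | refl => exact .refl _
    | @tail y z hy hyz ih =>
      rw [← reachable_iff_reflTransGen] at hy
      refine ih.trans (Adj.reachable ?_)
      rw [deleteEdges_adj] at hyz ⊢
      refine ⟨hyz.1, fun h => ?_⟩
      rcases Sym2.eq_iff.1 h with ⟨rfl, rfl⟩ | ⟨rfl, rfl⟩
      · exact hu' hy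
      · exact hv' hy
  apply Finset.card_lt_card
  rw [Finset.ssubset_iff_of_subset (fun x hx => by simpa using key x (by simpa using hx))]
  refine ⟨v, ?_, by simpa using hv⟩
  rw [mem_reachableFinset]
  refine (key u hu).trans (Adj.reachable ?_)
  rw [deleteEdges_adj]
  exact ⟨hadj, hne⟩

section Cut

variable {α : Type*} [Fintype α] {G : SimpleGraph α} {m s u v : α}

theorem disjoint_reachableFinset_deleteEdges (hG : G.IsAcyclic) (hadj : G.Adj u v)
    (hu : (G.deleteEdges {s(u, v)}).Reachable m u)
    (hv : (G.deleteEdges {s(u, v)}).Reachable s v) :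
    Disjoint (reachableFinset (G.deleteEdges {s(u, v)}) m)
      (reachableFinset (G.deleteEdges {s(u, v)}) s) := by
  rw [Finset.disjoint_left]
  intro x hx hx'
  rw [mem_reachableFinset] at hx hx'
  exact not_reachable_deleteEdges_of_isAcyclic hG hadj hu hv (hx.trans hx'.symm)

theorem reachableFinset_eq_union (hadj : G.Adj u v)
    (hu : (G.deleteEdges {s(u, v)}).Reachable m u)
    (hv : (G.deleteEdges {s(u, v)}).Reachable s v) :
    reachableFinset G m = reachableFinset (G.deleteEdges {s(u, v)}) m ∪
      reachableFinset (G.deleteEdges {s(u, v)}) s := by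
  ext x
  simp [reachable_iff_deleteEdges_or hadj hu hv x]

theorem card_reachableFinset_add (hG : G.IsAcyclic) (hadj : G.Adj u v)
    (hu : (G.deleteEdges {s(u, v)}).Reachable m u)
    (hv : (G.deleteEdges {s(u, v)}).Reachable s v) :
    (reachableFinset G m).card = (reachableFinset (G.deleteEdges {s(u, v)}) m).card +
      (reachableFinset (G.deleteEdges {s(u, v)}) s).card := by
  rw [reachableFinset_eq_union hadj hu hv, Finset.card_union_of_disjoint
    (disjoint_reachableFinset_deleteEdges hG hadj hu hv)]

theorem prod_reachableEdges (hG : G.IsAcyclic) (hadj : G.Adj u v)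
    (hu : (G.deleteEdges {s(u, v)}).Reachable m u)
    (hv : (G.deleteEdges {s(u, v)}).Reachable s v) (w : Sym2 α → ℝ) :
    ∏ e ∈ reachableEdges G m, w e = w s(u, v) *
      ((∏ e ∈ reachableEdges (G.deleteEdges {s(u, v)}) m, w e) *
        ∏ e ∈ reachableEdges (G.deleteEdges {s(u, v)}) s, w e) := by
  have hunion : reachableEdges G m = insert s(u, v)
      (reachableEdges (G.deleteEdges {s(u, v)}) m ∪
        reachableEdges (G.deleteEdges {s(u, v)}) s) := by
    ext e
    induction e with | _ x y
    simp only [Finset.mem_insert, Finset.mem_union, mk_mem_reachableEdges, deleteEdges_adj,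
      Set.mem_singleton_iff]
    rw [reachable_iff_deleteEdges_or hadj hu hv x]
    by_cases hE : s(x, y) = s(u, v)
    · simp only [hE, not_true_eq_false, and_false, false_and, or_false, iff_true]
      rcases Sym2.eq_iff.1 hE with ⟨rfl, rfl⟩ | ⟨rfl, rfl⟩
      · exact ⟨hadj, .inl hu⟩
      · exact ⟨hadj.symm, .inr hv⟩
    · simp only [hE, not_false_eq_true, and_true, false_or]
      tauto
  rw [hunion, Finset.prod_insert, Finset.prod_union]
  · rw [Finset.disjoint_left]
    intro e
    induction e with | _ x y
    rw [mk_mem_reachableEdges, mk_mem_reachableEdges]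
    exact fun h h' => not_reachable_deleteEdges_of_isAcyclic hG hadj hu hv (h.2.trans h'.2.symm)
  · simp [mk_mem_reachableEdges]

end Cut

theorem injOn_card_reachableFinset_deleteEdges {α : Type*} [Fintype α] {G : SimpleGraph α}
    (hG : G.IsAcyclic) {m s : α} (p : G.Walk m s) (hp : p.IsPath) :
    Set.InjOn (fun e => (reachableFinset (G.deleteEdges {e}) m).card) {e | e ∈ p.edges} := by
  intro e he e' he' hcard
  by_contra hne
  obtain ⟨u, v, rfl, hadj, hu, hv⟩ := exists_eq_of_mem_edges_of_isPath p hp he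
  obtain ⟨u', v', rfl, hadj', hu', hv'⟩ := exists_eq_of_mem_edges_of_isPath p hp he'
  have hms := not_reachable_deleteEdges_of_isAcyclic hG hadj hu hv
  have huv' : (G.deleteEdges {s(u, v)}).Reachable u' v' :=
    Adj.reachable (by rw [deleteEdges_adj]; exact ⟨hadj', fun h => hne h.symm⟩)
  have h1 := card_reachableFinset_add hG hadj hu hv
  have h2 := card_reachableFinset_add hG hadj' hu' hv'
  have hmu' : G.Reachable m u' := hu'.mono (deleteEdges_le _)
  rcases (reachable_iff_deleteEdges_or hadj hu hv u').1 hmu' with h | h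
  · have := card_reachableFinset_lt (m := s) (u := v) (v := u) (u' := v') (v' := u') hadj.symm
      (by rwa [Sym2.eq_swap]) (by rw [Sym2.eq_swap]; exact fun h => hms (hu.trans h.symm))
      (by rwa [Sym2.eq_swap, Sym2.eq_swap (a := v')])
      (by rw [Sym2.eq_swap]; exact fun h' => hms ((h.trans huv').trans h'.symm))
      (by rw [Sym2.eq_swap]; exact fun h' => hms (h.trans h'.symm))
    rw [Sym2.eq_swap, Sym2.eq_swap (a := v')] at this
    simp only at hcard
    omega
  · have := card_reachableFinset_lt hadj hu (fun h => hms (h.trans hv.symm)) hne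
      (fun h' => hms (h'.trans h.symm)) (fun h' => hms (h'.trans (h.trans huv').symm))
    simp only at hcard
    omega

theorem dist_le_sum_edges {α : Type*} [PseudoMetricSpace α] {G : SimpleGraph α}
    {w : Sym2 α → ℝ} (hw : ∀ x y, G.Adj x y → dist x y ≤ w s(x, y)) {m s : α}
    (p : G.Walk m s) : dist m s ≤ (p.edges.map w).sum := by
  induction p with
  | nil => simp
  | @cons a b c h q ih =>
    rw [Walk.edges_cons, List.map_cons, List.sum_cons]
    exact (dist_triangle a b c).trans (add_le_add (hw a b h) ih)

theorem sum_catalan_mul_catalan_le {ι : Type*} (P : Finset ι) (f : ι → ℕ) (hf : Set.InjOn f P)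
    (N : ℕ) (h1 : ∀ e ∈ P, 1 ≤ f e) (h2 : ∀ e ∈ P, f e < N) (hN : 2 ≤ N) :
    ∑ e ∈ P, catalan (f e - 1) * catalan (N - f e - 1) ≤ catalan (N - 1) := by
  obtain ⟨n, rfl⟩ : ∃ n, N = n + 2 := ⟨N - 2, by omega⟩
  rw [show n + 2 - 1 = n + 1 by omega, catalan_succ,
    Fin.sum_univ_eq_sum_range (fun i => catalan i * catalan (n - i))]
  have hinj : Set.InjOn (fun e => f e - 1) P := by
    intro e he e' he' h
    have := h1 e he
    have := h1 e' he'
    exact hf he he' (by simp only at h; omega)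
  calc _ = ∑ i ∈ P.image (fun e => f e - 1), catalan i * catalan (n - i) := by
        rw [Finset.sum_image hinj]
        refine Finset.sum_congr rfl fun e he => ?_
        have := h1 e he
        have := h2 e he
        congr 2
        omega
    _ ≤ _ := by
        refine Finset.sum_le_sum_of_subset fun i hi => ?_
        obtain ⟨e, he, rfl⟩ := Finset.mem_image.1 hi
        have := h1 e he
        have := h2 e he
        simp only [Finset.mem_range]
        omega

theorem catalan_le_four_pow (n : ℕ) : catalan n ≤ 4 ^ n := by
  rw [catalan_eq_centralBinom_div]
  refine (Nat.div_le_self _ _).trans ?_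
  rw [Nat.centralBinom_eq_two_mul_choose]
  refine (Nat.choose_le_two_pow _ _).trans_eq ?_
  rw [pow_mul]
  norm_num

/-- Some edge of the path from `m` to `s` is long enough to pay for `dist m s`, up to the
Catalan numbers of the sizes of the two components left by its removal. -/
theorem exists_edge_dist_mul_catalan_le {α : Type*} [Fintype α] [PseudoMetricSpace α]
    {G : SimpleGraph α} (hG : G.IsAcyclic) {w : Sym2 α → ℝ}
    (hw : ∀ x y, G.Adj x y → dist x y ≤ w s(x, y)) {m s : α} (hms : m ≠ s)
    (h : G.Reachable m s) :
    ∃ u v, G.Adj u v ∧ (G.deleteEdges {s(u, v)}).Reachable m u ∧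
      (G.deleteEdges {s(u, v)}).Reachable s v ∧
      dist m s * (catalan ((reachableFinset (G.deleteEdges {s(u, v)}) m).card - 1) *
          catalan ((reachableFinset (G.deleteEdges {s(u, v)}) s).card - 1)) ≤
        w s(u, v) * catalan ((reachableFinset G m).card - 1) := by
  obtain ⟨p, hp⟩ := h.exists_isPath
  set P : Finset (Sym2 α) := p.edges.toFinset with hP
  have hne : P.Nonempty := by
    rw [hP, List.toFinset_nonempty_iff]
    cases p with
    | nil => exact absurd rfl hms
    | cons => simp
  set A := fun e => (reachableFinset (G.deleteEdges {e}) m).card with hA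
  set N := (reachableFinset G m).card with hN
  have hcut : ∀ e ∈ P, 1 ≤ A e ∧ 1 ≤ (reachableFinset (G.deleteEdges {e}) s).card ∧
      N = A e + (reachableFinset (G.deleteEdges {e}) s).card := by
    intro e he
    obtain ⟨u, v, rfl, hadj, hu, hv⟩ :=
      exists_eq_of_mem_edges_of_isPath p hp (by simpa [P] using he)
    exact ⟨Finset.card_pos.2 ⟨m, by simp⟩, Finset.card_pos.2 ⟨s, by simp⟩,
      card_reachableFinset_add hG hadj hu hv⟩
  have hdist : dist m s ≤ ∑ e ∈ P, w e := by
    rw [hP, List.sum_toFinset _ hp.isTrail.edges_nodup]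
    exact dist_le_sum_edges hw p
  have hcat : ∑ e ∈ P, catalan (A e - 1) * catalan (N - A e - 1) ≤ catalan (N - 1) := by
    refine sum_catalan_mul_catalan_le P A ?_ N (fun e he => (hcut e he).1) (fun e he => ?_) ?_
    · convert injOn_card_reachableFinset_deleteEdges hG p hp using 1
      ext e
      simp [P]
    · have := hcut e he
      omega
    · obtain ⟨e, he⟩ := hne
      have := hcut e he
      omega
  obtain ⟨e, he, hle⟩ : ∃ e ∈ P, dist m s * ((catalan (A e - 1) * catalan (N - A e - 1) : ℕ) : ℝ) ≤
      w e * catalan (N - 1) := by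
    refine Finset.exists_le_of_sum_le hne ?_
    rw [← Finset.mul_sum, ← Finset.sum_mul, ← Nat.cast_sum]
    exact mul_le_mul hdist (by exact_mod_cast hcat) (by positivity) (dist_nonneg.trans hdist)
  have hc := hcut e he
  obtain ⟨u, v, rfl, hadj, hu, hv⟩ := exists_eq_of_mem_edges_of_isPath p hp (by simpa [P] using he)
  refine ⟨u, v, hadj, hu, hv, ?_⟩
  rw [show N - A s(u, v) = (reachableFinset (G.deleteEdges {s(u, v)}) s).card by omega] at hle
  exact_mod_cast hle

/-- Bound for the component of `m` in a forest, where `m` comes first in the order `r`: cut the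
path between the first two vertices and recurse on both sides. -/
theorem prod_le_catalan_mul_prod_edges {α : Type*} [Fintype α] [PseudoMetricSpace α]
    (r : α → ℕ) (hr : Function.Injective r) (a : α → ℝ) (ha : ∀ x, 0 ≤ a x)
    (had : ∀ x y, r x < r y → a y ≤ dist x y) (w : Sym2 α → ℝ) (hw0 : ∀ e, 0 ≤ w e) (N : ℕ) :
    ∀ (G : SimpleGraph α), G.IsAcyclic → (∀ x y, G.Adj x y → dist x y ≤ w s(x, y)) →
      ∀ m, (∀ x, G.Reachable m x → r m ≤ r x) → (reachableFinset G m).card = N →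
      ∏ k ∈ (reachableFinset G m).erase m, a k ≤
        catalan ((reachableFinset G m).card - 1) * ∏ e ∈ reachableEdges G m, w e := by
  induction N using Nat.strong_induction_on with | _ N ih
  intro G hG hw m hm hN
  rcases ((reachableFinset G m).erase m).eq_empty_or_nonempty with hemp | hne
  · have hall : ∀ x, G.Reachable m x → x = m := fun x hx => by
      by_contra hxm
      have : x ∈ (reachableFinset G m).erase m := by simp [hxm, hx]
      simp [hemp] at this
    have h1 : (reachableFinset G m).card = 1 := by
      rw [Finset.card_eq_one]
      refine ⟨m, Finset.ext fun x => ?_⟩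
      rw [mem_reachableFinset, Finset.mem_singleton]
      exact ⟨hall x, by rintro rfl; exact .refl _⟩
    have h2 : reachableEdges G m = ∅ := by
      rw [Finset.eq_empty_iff_forall_notMem]
      intro e
      induction e with | _ x y
      rw [mk_mem_reachableEdges]
      rintro ⟨hxy, hx⟩
      exact hxy.ne ((hall x hx).trans (hall y (hx.trans hxy.reachable)).symm)
    simp [hemp, h1, h2]
  obtain ⟨s, hs, hsmin⟩ := Finset.exists_min_image _ r hne
  rw [Finset.mem_erase, mem_reachableFinset] at hs
  obtain ⟨u, v, hadj, hu, hv, hle⟩ := exists_edge_dist_mul_catalan_le hG hw hs.1.symm hs.2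
  have hsub := reachable_iff_deleteEdges_or hadj hu hv
  have hdisj := disjoint_reachableFinset_deleteEdges hG hadj hu hv
  have hunion := reachableFinset_eq_union hadj hu hv
  have hcard := card_reachableFinset_add hG hadj hu hv
  have hprod := prod_reachableEdges hG hadj hu hv w
  have hnot := not_reachable_deleteEdges_of_isAcyclic hG hadj hu hv
  set G' := G.deleteEdges {s(u, v)} with hG'
  have hle' : G' ≤ G := deleteEdges_le _
  have hA : 0 < (reachableFinset G' m).card := Finset.card_pos.2 ⟨m, by simp⟩
  have hB : 0 < (reachableFinset G' s).card := Finset.card_pos.2 ⟨s, by simp⟩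
  have ihA := ih _ (by omega) G' (hG.anti hle') (fun x y h => hw x y (hle' h)) m
    (fun x hx => hm x (hx.mono hle')) rfl
  have ihB := ih _ (by omega) G' (hG.anti hle') (fun x y h => hw x y (hle' h)) s
    (fun x hx => hsmin x (by
      rw [Finset.mem_erase, mem_reachableFinset, hsub]
      exact ⟨by rintro rfl; exact hnot hx.symm, .inr hx⟩)) rfl
  have hrms : r m < r s := lt_of_le_of_ne (hm s hs.2) fun h => hs.1 (hr h).symm
  have hsplit : ∏ k ∈ (reachableFinset G m).erase m, a k =
      a s * ((∏ k ∈ (reachableFinset G' m).erase m, a k) *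
        ∏ k ∈ (reachableFinset G' s).erase s, a k) := by
    have hmB : m ∉ reachableFinset G' s := by
      rw [mem_reachableFinset]; exact fun h => hnot h.symm
    rw [hunion, Finset.erase_union_distrib, Finset.erase_eq_of_notMem hmB,
      Finset.prod_union (hdisj.mono_left (Finset.erase_subset _ _)),
      ← Finset.mul_prod_erase (reachableFinset G' s) a (a := s) (by simp)]
    ring
  rw [hsplit, hprod]
  have hwA : 0 ≤ ∏ e ∈ reachableEdges G' m, w e := Finset.prod_nonneg fun e _ => hw0 e
  have hwB : 0 ≤ ∏ e ∈ reachableEdges G' s, w e := Finset.prod_nonneg fun e _ => hw0 e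
  calc _ ≤ dist m s * ((catalan ((reachableFinset G' m).card - 1) *
            ∏ e ∈ reachableEdges G' m, w e) *
          (catalan ((reachableFinset G' s).card - 1) * ∏ e ∈ reachableEdges G' s, w e)) := by
        refine mul_le_mul (had m s hrms) (mul_le_mul ihA ihB
          (Finset.prod_nonneg fun e _ => ha e) (by positivity)) ?_ dist_nonneg
        exact mul_nonneg (Finset.prod_nonneg fun e _ => ha e)
          (Finset.prod_nonneg fun e _ => ha e)
    _ = dist m s * (catalan ((reachableFinset G' m).card - 1) *
          catalan ((reachableFinset G' s).card - 1)) *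
          ((∏ e ∈ reachableEdges G' m, w e) * ∏ e ∈ reachableEdges G' s, w e) := by ring
    _ ≤ _ := by
        refine (mul_le_mul_of_nonneg_right hle (by positivity)).trans_eq ?_
        ring

end

theorem prod_le_four_pow_mul_prod_edges {α : Type*} [Fintype α] [DecidableEq α]
    [PseudoMetricSpace α] {G : SimpleGraph α} (hG : G.IsTree) (r : α → ℕ)
    (hr : Function.Injective r) (m : α) (hm : ∀ x, r m ≤ r x) (a : α → ℝ) (ha : ∀ x, 0 ≤ a x)
    (had : ∀ x y, r x < r y → a y ≤ dist x y) (w : Sym2 α → ℝ) (hw0 : ∀ e, 0 ≤ w e)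
    (hw : ∀ x y, G.Adj x y → dist x y ≤ w s(x, y)) :
    ∏ k ∈ Finset.univ.erase m, a k ≤
      4 ^ (Fintype.card α - 1) * ∏ᶠ e ∈ G.edgeSet, w e := by
  have hreach : ∀ x, G.Reachable m x := fun x => hG.connected.preconnected m x
  have h := prod_le_catalan_mul_prod_edges r hr a ha had w hw0 _ G hG.isAcyclic hw m
    (fun x _ => hm x) rfl
  have h1 : reachableFinset G m = Finset.univ := by ext; simp [hreach]
  have h2 : (reachableEdges G m : Set (Sym2 α)) = G.edgeSet := by
    ext e; simp [mem_reachableEdges, hreach]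
  have h3 : @Finset.erase α (Classical.decEq α) (reachableFinset G m) m =
      Finset.univ.erase m := by
    ext x; simp [h1]
  rw [h3] at h
  rw [← h2, finprod_mem_coe_finset]
  refine h.trans (mul_le_mul_of_nonneg_right ?_ (Finset.prod_nonneg fun e _ => hw0 e))
  rw [h1, Finset.card_univ]
  exact_mod_cast catalan_le_four_pow _

/-- Consider terminals `t 1, …, t n` (`n ≥ 2`, pairwise distinct) in a `μ`-near
metric space `GD` (complete graph with weights `d` approximating the metric `dist`
within factor `μ`).  For `2 ≤ k ≤ n` the cost of a minimum-cost edge `f_k`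
connecting `t k` with `{t 1, …, t (k-1)}` is `sInf {d s(t j, t k) | 1 ≤ j < k}`.
If `T = MST(GD[S])` is a minimum-weight spanning tree of `GD` restricted to
`S = {t 1, …, t n}`, then `∏_{k=2}^n d(f_k) ≤ (4μ)^{n-1} · ∏_{e ∈ E(T)} d(e)`. -/
theorem stmt3 {V : Type*} [Fintype V] [MetricSpace V]
    (μ : ℝ) (hμ : 1 ≤ μ)
    (d : Sym2 V → ℝ)
    (hlb : ∀ u v : V, dist u v ≤ d s(u, v))
    (hub : ∀ u v : V, d s(u, v) ≤ μ * dist u v)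
    (n : ℕ) (hn : 2 ≤ n) (t : ℕ → V)
    (ht : Set.InjOn t (Set.Icc 1 n))
    (T : (⊤ : SimpleGraph V).Subgraph) (hT : T.coe.IsTree)
    (hTv : T.verts = t '' Set.Icc 1 n)
    (hTmin : ∀ T' : (⊤ : SimpleGraph V).Subgraph, T'.coe.IsTree →
      T'.verts = t '' Set.Icc 1 n → subWeight d T ≤ subWeight d T') :
    ∏ k ∈ Finset.Icc 2 n, sInf {x | ∃ j, 1 ≤ j ∧ j < k ∧ x = d s(t j, t k)}
      ≤ (4 * μ) ^ (n - 1) * ∏ᶠ e ∈ T.edgeSet, d e := by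
  classical
  choose r hr hrt using fun x : T.verts => (hTv ▸ x.2 : (x : V) ∈ t '' Set.Icc 1 n)
  have hmem : ∀ k ∈ Set.Icc 1 n, t k ∈ T.verts := fun k hk => hTv ▸ Set.mem_image_of_mem t hk
  have hrt' : ∀ k (hk : k ∈ Set.Icc 1 n), r ⟨t k, hmem k hk⟩ = k := fun k hk =>
    ht (hr ⟨t k, hmem k hk⟩) hk (hrt ⟨t k, hmem k hk⟩)
  have hrinj : Function.Injective r := fun x y h => Subtype.ext (by rw [← hrt x, ← hrt y, h])
  have hd : ∀ e, 0 ≤ d e := fun e => by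
    induction e with | _ x y
    exact dist_nonneg.trans (hlb x y)
  have hμ0 : 0 < μ := by linarith
  set c : ℕ → ℝ := fun k => sInf {x | ∃ j, 1 ≤ j ∧ j < k ∧ x = d s(t j, t k)} with hc
  have hc0 : ∀ k, 0 ≤ c k := fun k => Real.sInf_nonneg (by rintro _ ⟨j, -, -, rfl⟩; exact hd _)
  have hcle : ∀ j k, 1 ≤ j → j < k → c k ≤ μ * dist (t j) (t k) := fun j k h1 h2 =>
    le_trans (csInf_le ⟨0, by rintro _ ⟨j, -, -, rfl⟩; exact hd _⟩ ⟨j, h1, h2, rfl⟩) (hub _ _)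
  have h1n : 1 ∈ Set.Icc 1 n := ⟨le_rfl, by omega⟩
  let m : T.verts := ⟨t 1, hmem 1 h1n⟩
  have key := prod_le_four_pow_mul_prod_edges hT r hrinj m
    (fun x => by rw [hrt' 1 h1n]; exact (hr x).1) (fun x => c (r x) / μ)
    (fun x => div_nonneg (hc0 _) hμ0.le)
    (fun x y h => by
      rw [div_le_iff₀' hμ0, Subtype.dist_eq, ← hrt x, ← hrt y]
      exact hcle _ _ (hr x).1 h)
    (fun e => d (e.map Subtype.val)) (fun e => hd _) (fun x y _ => hlb x y)
  have hcardV : Fintype.card T.verts = n := by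
    rw [← Nat.card_eq_fintype_card, Nat.card_coe_set_eq, hTv, ht.ncard_image,
      Set.ncard_eq_toFinset_card']
    simp
  have hedges : ∏ᶠ e ∈ T.coe.edgeSet, d (e.map Subtype.val) = ∏ᶠ e ∈ T.edgeSet, d e := by
    rw [← T.image_coe_edgeSet_coe,
      finprod_mem_image (Sym2.map.injective Subtype.val_injective).injOn]
  have hterm : ∏ x ∈ Finset.univ.erase m, c (r x) = ∏ k ∈ Finset.Icc 2 n, c k := by
    refine Finset.prod_nbij r (fun x hx => ?_) hrinj.injOn (fun k hk => ?_) fun _ _ => rfl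
    · have h1 : r x ≠ 1 := fun h => (Finset.ne_of_mem_erase hx)
        (hrinj (h.trans (hrt' 1 h1n).symm))
      have := hr x
      simp only [Set.mem_Icc] at this
      rw [Finset.mem_Icc]
      omega
    · simp only [Finset.coe_Icc, Set.mem_Icc] at hk
      have hk' : k ∈ Set.Icc 1 n := ⟨by omega, hk.2⟩
      refine ⟨⟨t k, hmem k hk'⟩, ?_, hrt' k hk'⟩
      simp only [Finset.coe_erase, Finset.coe_univ, Set.mem_sdiff, Set.mem_univ,
        Set.mem_singleton_iff, true_and]
      intro h
      have := congrArg r h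
      rw [hrt' k hk', hrt' 1 h1n] at this
      omega
  rw [Finset.prod_div_distrib, Finset.prod_const, Finset.card_erase_of_mem (Finset.mem_univ _),
    Finset.card_univ, hcardV, hterm, hedges, div_le_iff₀ (pow_pos hμ0 _)] at key
  refine key.trans_eq ?_
  rw [mul_pow]
  ring
end

section
/- Let T and T' be two trees on the same finite vertex set, i.e. V(T) = V(T'). Then there exists a bijection π: E(T) → E(T') such that for every edge e ∈ E(T), the edge e lies on the unique path in T between the two endpoints of π(e) (that is, e is a friend of π(e) with respect to T). -/
open SimpleGraph

/-- `e` is a friend of `e'` with respect to the tree `T`: `e` is an edge of `T`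
lying on the (unique, since `T` is a tree) path in `T` between the endpoints
of `e'`. -/
def FriendOf {V : Type*} (T : SimpleGraph V) (e e' : Sym2 V) : Prop :=
  e ∈ T.edgeSet ∧ ∃ u v : V, e' = s(u, v) ∧
    ∃ p : T.Walk u v, p.IsPath ∧ e ∈ p.edges

/-- Removing a set `A` of edges from a connected graph `T` and adding all edges of a connected graph
`T'` having a friend in `A` leaves the graph connected. -/
theorem connected_fromEdgeSet_sdiff_union_friendOf {V : Type*} {T T' : SimpleGraph V}
    (hT : T.Connected) (hT' : T'.Connected) (A : Set (Sym2 V)) :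
    (fromEdgeSet (T.edgeSet \ A ∪
      {e' | e' ∈ T'.edgeSet ∧ ∃ e ∈ A, FriendOf T e e'})).Connected := by
  set G := fromEdgeSet (T.edgeSet \ A ∪ {e' | e' ∈ T'.edgeSet ∧ ∃ e ∈ A, FriendOf T e e'}) with hG
  have hadj : ∀ u v, T'.Adj u v → G.Reachable u v := by
    intro u v huv
    by_cases h : ∃ e ∈ A, FriendOf T e s(u, v)
    · exact Adj.reachable ((fromEdgeSet_adj _).2 ⟨Or.inr ⟨huv, h⟩, huv.ne⟩)
    · obtain ⟨p, hp⟩ := hT.exists_isPath u v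
      refine ⟨p.transfer G fun e he => ?_⟩
      have heT := p.edges_subset_edgeSet he
      rw [hG, edgeSet_fromEdgeSet]
      exact ⟨Or.inl ⟨heT, fun heA => h ⟨e, heA, heT, u, v, rfl, p, hp, he⟩⟩,
        T.not_isDiag_of_mem_edgeSet heT⟩
  have := hT.nonempty
  refine ⟨fun u v => ?_⟩
  obtain ⟨p⟩ := hT'.preconnected u v
  induction p with
  | nil => exact Reachable.refl _
  | cons h _ ih => exact (hadj _ _ h).trans ih

/-- Hall's condition for the friend relation between a tree and a connected graph. -/
theorem ncard_le_ncard_friendOf {V : Type*} [Finite V] {T T' : SimpleGraph V}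
    (hT : T.IsTree) (hT' : T'.Connected) {A : Set (Sym2 V)} (hA : A ⊆ T.edgeSet) :
    A.ncard ≤ {e' | e' ∈ T'.edgeSet ∧ ∃ e ∈ A, FriendOf T e e'}.ncard := by
  have hconn := (connected_fromEdgeSet_sdiff_union_friendOf hT.connected hT' A)
    |>.card_vert_le_card_edgeSet_add_one
  have hcard := (isTree_iff_connected_and_card.1 hT).2
  rw [Nat.card_coe_set_eq] at hconn hcard
  have hle := Set.ncard_le_ncard ((edgeSet_fromEdgeSet _).trans_subset
    (Set.sdiff_subset (s := T.edgeSet \ A ∪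
      {e' | e' ∈ T'.edgeSet ∧ ∃ e ∈ A, FriendOf T e e'})))
  have hunion := Set.ncard_union_le (T.edgeSet \ A)
    {e' | e' ∈ T'.edgeSet ∧ ∃ e ∈ A, FriendOf T e e'}
  have hdiff := Set.ncard_sdiff_add_ncard_of_subset hA
  lia

/-- Let `T` and `T'` be two trees on the same finite vertex set `V`.  Then there
exists a bijection `π : E(T) → E(T')` such that every edge `e ∈ E(T)` lies on the
unique path in `T` between the two endpoints of `π e`, i.e. `e` is a friend of
`π e` with respect to `T`. -/
theorem stmt4 {V : Type*} [Fintype V]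
    (T T' : SimpleGraph V) (hT : T.IsTree) (hT' : T'.IsTree) :
    ∃ π : T.edgeSet → T'.edgeSet, Function.Bijective π ∧
      ∀ e : T.edgeSet, FriendOf T (e : Sym2 V) ((π e : Sym2 V)) := by
  classical
  obtain ⟨π, hinj, hπ⟩ := (Fintype.all_card_le_filter_rel_iff_exists_injective
    fun (e : T.edgeSet) (e' : T'.edgeSet) => FriendOf T (e : Sym2 V) (e' : Sym2 V)).1 fun A => by
      have h := ncard_le_ncard_friendOf hT hT'.connected
        (A := Subtype.val '' (A : Set T.edgeSet)) (by simp)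
      rw [Set.ncard_image_of_injective _ Subtype.val_injective, Set.ncard_coe_finset] at h
      refine h.trans_eq ?_
      rw [← Set.ncard_coe_finset, ← Set.ncard_image_of_injective _ Subtype.val_injective]
      congr 1
      ext e'
      simp [and_comm]
  have h := (isTree_iff_connected_and_card.1 hT).2
  have h' := (isTree_iff_connected_and_card.1 hT').2
  exact ⟨π, hinj.bijective_of_nat_card_le (by lia), hπ⟩
end

section
/- Let τ ≥ 0 and let T be a tree whose vertex set is contained in the vertex set V of a complete weighted graph GD = (V, binom(V,2), d_GD). If T does not admit any τ-efficient replacement pair, then d_GD(T) ≤ (1+τ) · d_GD(MST(GD[V(T)])), i.e. T is a (1+τ)-approximation of a minimum spanning tree of V(T). -/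
open SimpleGraph

/-- `(e, eT)` is a replacement pair in the tree `H`: `e` is an edge of the complete
graph with both (distinct) endpoints in `V(H)`, and `eT` is an edge of `H` lying on
the unique path in `H` between the endpoints of `e` (i.e. `eT` is a friend of `e`). -/
def IsReplacementPair {V : Type*} (H : (⊤ : SimpleGraph V).Subgraph)
    (e eT : Sym2 V) : Prop :=
  ∃ u v : V, u ≠ v ∧ e = s(u, v) ∧ u ∈ H.verts ∧ v ∈ H.verts ∧
    eT ∈ H.edgeSet ∧ ∃ p : H.spanningCoe.Walk u v, p.IsPath ∧ eT ∈ p.edges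

/-- Adding isolated vertices to an acyclic graph keeps it acyclic. -/
theorem SimpleGraph.IsAcyclic.spanningCoe {V : Type*} {s : Set V} {H : SimpleGraph s}
    (h : H.IsAcyclic) : H.spanningCoe.IsAcyclic := by
  intro v w hw
  have hs : ∀ x ∈ w.support, x ∈ s := by
    intro x hx
    obtain ⟨e, he, hxe⟩ := (Walk.mem_support_iff_exists_mem_edges_of_not_nil hw.not_nil).1 hx
    obtain ⟨y, rfl⟩ := Sym2.mem_iff_exists.1 hxe
    exact Subgraph.mem_of_adj_spanningCoe H (w.adj_of_mem_edges he)
  have hi : (H.spanningCoe.induce s).IsAcyclic := by rwa [induce_spanningCoe]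
  refine hi (w.induce s hs) ?_
  rw [← Walk.isCycle_map_iff_of_injective (f := (Embedding.induce (G := H.spanningCoe) s).toHom)
    (Embedding.induce (G := H.spanningCoe) s).injective]
  rwa [Walk.map_induce]

/-- A forest whose edges join vertices connected in a graph `F` has at most as many edges
as `F`. -/
theorem SimpleGraph.IsAcyclic.ncard_edgeSet_le {V : Type*} [Finite V] {G F : SimpleGraph V}
    (hG : G.IsAcyclic) (h : ∀ u v, G.Adj u v → F.Reachable u v) :
    G.edgeSet.ncard ≤ F.edgeSet.ncard := by
  cases isEmpty_or_nonempty V with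
  | inl _ => simp [Subsingleton.elim G F]
  | inr _ =>
    obtain ⟨T, hGT, -, hT⟩ := (connected_top (V := V)).exists_isTree_le_of_le_of_isAcyclic
      le_top hG
    have hreach : ∀ u v, T.Adj u v → (F ⊔ T \ G).Reachable u v := by
      intro u v huv
      by_cases hg : G.Adj u v
      · exact (h u v hg).mono le_sup_left
      · exact (Adj.reachable (G := T \ G) ⟨huv, hg⟩).mono le_sup_right
    have hconn : (F ⊔ T \ G).Connected := by
      refine ⟨fun u v => ?_⟩
      obtain ⟨p⟩ := hT.connected.preconnected u v
      induction p with
      | nil => rfl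
      | cons hadj _ ih => exact (hreach _ _ hadj).trans ih
    have h1 := hconn.card_vert_le_card_edgeSet_add_one
    have h2 := (isTree_iff_connected_and_card.1 hT).2
    rw [Nat.card_coe_set_eq] at h1 h2
    rw [edgeSet_sup, edgeSet_sdiff] at h1
    have h3 := Set.ncard_union_le F.edgeSet (T.edgeSet \ G.edgeSet)
    have h4 := Set.ncard_sdiff_add_ncard_of_subset (edgeSet_mono hGT) (Set.toFinite _)
    omega

theorem SimpleGraph.Subgraph.Connected.reachable_spanningCoe {V : Type*} {G : SimpleGraph V}
    {H : G.Subgraph} (h : H.coe.Connected) {u v : V} (hu : u ∈ H.verts) (hv : v ∈ H.verts) :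
    H.spanningCoe.Reachable u v :=
  (h.preconnected ⟨u, hu⟩ ⟨v, hv⟩).map ⟨Subtype.val, fun h => h⟩

/-- Two trees on the same vertices have edge sets in bijection in such a way that
corresponding edges form replacement pairs. -/
theorem exists_bijective_isReplacementPair {V : Type*} [Fintype V]
    {T T' : (⊤ : SimpleGraph V).Subgraph} (hT : T.coe.IsTree) (hT' : T'.coe.IsTree)
    (hverts : T'.verts = T.verts) :
    ∃ f : T'.edgeSet → T.edgeSet, Function.Bijective f ∧
      ∀ e : T'.edgeSet, IsReplacementPair T e (f e) := by
  classical
  have hac : T.spanningCoe.IsAcyclic := by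
    rw [← Subgraph.spanningCoe_coe]; exact hT.isAcyclic.spanningCoe
  have hac' : T'.spanningCoe.IsAcyclic := by
    rw [← Subgraph.spanningCoe_coe]; exact hT'.isAcyclic.spanningCoe
  have hle : T.edgeSet.ncard ≤ T'.edgeSet.ncard := by
    rw [← Subgraph.edgeSet_spanningCoe, ← Subgraph.edgeSet_spanningCoe]
    refine hac.ncard_edgeSet_le fun u v huv => ?_
    rw [Subgraph.spanningCoe_adj] at huv
    exact Subgraph.Connected.reachable_spanningCoe hT'.connected
      (hverts ▸ huv.fst_mem) (hverts ▸ huv.snd_mem)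
  obtain ⟨f, hf, hr⟩ := (Fintype.all_card_le_filter_rel_iff_exists_injective
      fun (e : T'.edgeSet) (eT : T.edgeSet) => IsReplacementPair T e eT).1 fun A => by
    set B : Finset T.edgeSet := {b | ∃ a ∈ A, IsReplacementPair T a b} with hB
    let S : Set (Sym2 V) := Subtype.val '' (A : Set T'.edgeSet)
    let N : Set (Sym2 V) := Subtype.val '' (B : Set T.edgeSet)
    have hS : (fromEdgeSet S).edgeSet = S := by
      rw [edgeSet_fromEdgeSet, sdiff_eq_left, Set.disjoint_left]
      rintro _ ⟨e, -, rfl⟩ hd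
      exact not_isDiag_of_mem_edgeSet _ (T'.edgeSet_subset e.2) hd
    have hSle : fromEdgeSet S ≤ T'.spanningCoe := by
      rw [← edgeSet_subset_edgeSet, hS, Subgraph.edgeSet_spanningCoe]
      rintro _ ⟨e, -, rfl⟩
      exact e.2
    have key := (hac'.anti hSle).ncard_edgeSet_le (F := fromEdgeSet N) fun u v huv => by
      have huv' : T'.Adj u v := hSle huv
      have hu : u ∈ T.verts := hverts ▸ huv'.fst_mem
      have hv : v ∈ T.verts := hverts ▸ huv'.snd_mem
      obtain ⟨p, hp⟩ := (Subgraph.Connected.reachable_spanningCoe hT.connected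
        hu hv).exists_isPath
      refine ⟨p.transfer _ fun e he => ?_⟩
      have heT : e ∈ T.edgeSet := by
        simpa using p.edges_subset_edgeSet he
      rw [edgeSet_fromEdgeSet]
      refine ⟨⟨⟨e, heT⟩, ?_, rfl⟩, not_isDiag_of_mem_edgeSet _ (T.edgeSet_subset heT)⟩
      have hmem : s(u, v) ∈ S := ((fromEdgeSet_adj S).1 huv).1
      obtain ⟨a, ha, hae⟩ := hmem
      simp only [hB, Finset.coe_filter, Finset.mem_univ, true_and, Set.mem_ofPred_eq]
      exact ⟨a, ha, u, v, huv.ne, hae, hu, hv, heT, p, hp, he⟩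
    rw [hS] at key
    have h2 : (fromEdgeSet N).edgeSet.ncard ≤ N.ncard := by
      rw [edgeSet_fromEdgeSet]
      exact Set.ncard_le_ncard Set.sdiff_subset (Set.toFinite _)
    have h3 := key.trans h2
    rwa [Set.ncard_image_of_injective _ Subtype.val_injective,
      Set.ncard_image_of_injective _ Subtype.val_injective,
      Set.ncard_coe_finset, Set.ncard_coe_finset] at h3
  refine ⟨f, ?_, hr⟩
  exact hf.bijective_of_nat_card_le (by simpa only [Nat.card_coe_set_eq] using hle)

/-- Let `τ ≥ 0` and let `T` be a tree with vertices in the vertex set `V` of a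
complete weighted graph `GD = (V, d)`.  If `T` admits no `τ`-efficient replacement
pair (a replacement pair `(e, eT)` with `(1+τ)·d(e) < d(eT)`), then
`d(T) ≤ (1+τ) · d(MST(GD[V(T)]))`, where `TM = MST(GD[V(T)])` is a minimum-weight
spanning tree of `GD` restricted to `V(T)`. -/
theorem stmt6 {V : Type*} [Fintype V]
    (d : Sym2 V → ℝ) (τ : ℝ) (hτ : 0 ≤ τ)
    (T : (⊤ : SimpleGraph V).Subgraph) (hT : T.coe.IsTree)
    (hno : ¬ ∃ e eT : Sym2 V, IsReplacementPair T e eT ∧ (1 + τ) * d e < d eT)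
    (TM : (⊤ : SimpleGraph V).Subgraph) (hTM : TM.coe.IsTree) (hTMv : TM.verts = T.verts)
    (hTMmin : ∀ T' : (⊤ : SimpleGraph V).Subgraph, T'.coe.IsTree → T'.verts = T.verts →
      subWeight d TM ≤ subWeight d T') :
    subWeight d T ≤ (1 + τ) * subWeight d TM := by
  classical
  obtain ⟨f, hf, hr⟩ := exists_bijective_isReplacementPair hT hTM hTMv
  have hsum : ∀ H : (⊤ : SimpleGraph V).Subgraph, subWeight d H = ∑ e : H.edgeSet, d e := by
    intro H
    rw [subWeight, ← finsum_set_coe_eq_finsum_mem, finsum_eq_sum_of_fintype]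
  rw [hsum, hsum, ← hf.sum_comp (fun e : T.edgeSet => d e), Finset.mul_sum]
  refine Finset.sum_le_sum fun e _ => ?_
  by_contra hlt
  exact hno ⟨e, f e, hr e, not_le.1 hlt⟩
end

section
/- Let T be a tree whose vertex set is contained in the vertex set V of a complete weighted graph GD = (V, binom(V,2), d_GD). Let 𝒯 be a family of pairwise vertex-disjoint subtrees of T such that there exists a subtree T^c of T with |V(T^c) ∩ V(T̂)| = 1 for every T̂ ∈ 𝒯, and let F be a set of edges of GD such that (a) each edge of F connects two different trees of 𝒯, and (b) T' := F ∪ ⋃𝒯 is a tree. Let (e, e') be a replacement pair in T'. Then at least one of the following holds: (1) (e, e') is a replacement pair in T; (2) e' ∈ F; or (3) there exists f ∈ F such that (e, f) is a replacement pair in T' and (f, e') is a replacement pair in T. -/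
open SimpleGraph

namespace SimpleGraph

variable {V : Type*} {G : SimpleGraph V}

lemma Walk.iff_of_forall_edges_iff {P : V → Prop} {u v : V} (p : G.Walk u v)
    (h : ∀ x y, s(x, y) ∈ p.edges → (P x ↔ P y)) : P u ↔ P v := by
  induction p with
  | nil => rfl
  | cons hadj q ih =>
    exact (h _ _ (by simp)).trans (ih fun x y hxy => h x y (by simp [hxy]))

lemma Walk.IsTrail.not_iff_of_unique_edge {P : V → Prop} {a b u v : V} {p : G.Walk u v}
    (hp : p.IsTrail) (hab : s(a, b) ∈ p.edges) (hP : ¬(P a ↔ P b))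
    (h : ∀ x y, s(x, y) ∈ p.edges → s(x, y) ≠ s(a, b) → (P x ↔ P y)) : ¬(P u ↔ P v) := by
  induction p with
  | nil => simp at hab
  | @cons u w v hadj q ih =>
    rw [isTrail_cons] at hp
    rw [edges_cons, List.mem_cons] at hab
    by_cases heq : s(a, b) = s(u, w)
    · have hq : P w ↔ P v := q.iff_of_forall_edges_iff fun x y hxy =>
        h x y (by simp [hxy]) fun hc => hp.2 (heq ▸ hc ▸ hxy)
      rw [Sym2.eq_iff] at heq
      rcases heq with ⟨rfl, rfl⟩ | ⟨rfl, rfl⟩ <;> tauto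
    · have hq := ih hp.1 (hab.resolve_left heq) fun x y hxy => h x y (by simp [hxy])
      have huw := h u w (by simp) (Ne.symm heq)
      tauto

/-- An edge of a subgraph that is a forest splits the vertices into two sides, and it is the only
edge of the subgraph whose endpoints lie on different sides. -/
lemma Subgraph.exists_separation_of_isAcyclic {H : G.Subgraph} (hH : H.coe.IsAcyclic) {a b : V}
    (hab : H.Adj a b) :
    ∃ P : V → Prop, ¬(P a ↔ P b) ∧
      ∀ x y, H.Adj x y → s(x, y) ≠ s(a, b) → (P x ↔ P y) := by
  let a' : H.verts := ⟨a, hab.fst_mem⟩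
  let b' : H.verts := ⟨b, hab.snd_mem⟩
  have hbridge : H.coe.IsBridge s(a', b') := isAcyclic_iff_forall_isBridge.mp hH hab
  refine ⟨fun x => ∃ hx : x ∈ H.verts, (H.coe.deleteEdges {s(a', b')}).Reachable a' ⟨x, hx⟩,
    ?_, fun x y hxy hne => ?_⟩
  · exact fun h => isBridge_iff.mp hbridge (h.mp ⟨_, .rfl⟩).2
  · have hadj : (H.coe.deleteEdges {s(a', b')}).Adj ⟨x, hxy.fst_mem⟩ ⟨y, hxy.snd_mem⟩ := by
      rw [SimpleGraph.deleteEdges_adj]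
      refine ⟨hxy, fun hc => hne ?_⟩
      simpa [a', b'] using congrArg (Sym2.map Subtype.val) hc
    exact ⟨fun h => ⟨hxy.snd_mem, h.2.trans hadj.reachable⟩,
      fun h => ⟨hxy.fst_mem, h.2.trans hadj.reachable.symm⟩⟩

end SimpleGraph

/-- Let `T` be a tree with vertices in the vertex set `V` of a complete weighted
graph, let `𝒯` be a family of pairwise vertex-disjoint subtrees of `T` such that
some subtree `Tc` of `T` meets each member of `𝒯` in exactly one vertex, and let
`F` be a set of edges of the complete graph, each connecting two different trees of
`𝒯`, such that `T' := F ∪ ⋃ 𝒯` is a tree.  Then any replacement pair `(e, e')` in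
`T'` satisfies: (1) `(e, e')` is a replacement pair in `T`; or (2) `e' ∈ F`; or
(3) there is `f ∈ F` such that `(e, f)` is a replacement pair in `T'` and
`(f, e')` is a replacement pair in `T`. -/
theorem stmt10 {V : Type*} [Fintype V]
    (T : (⊤ : SimpleGraph V).Subgraph) (hT : T.coe.IsTree)
    (𝒯 : Set ((⊤ : SimpleGraph V).Subgraph))
    (h𝒯sub : ∀ A ∈ 𝒯, A ≤ T ∧ A.coe.IsTree)
    (h𝒯disj : ∀ A ∈ 𝒯, ∀ B ∈ 𝒯, A ≠ B → A.verts ∩ B.verts = ∅)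
    (Tc : (⊤ : SimpleGraph V).Subgraph) (hTcsub : Tc ≤ T) (hTc : Tc.coe.IsTree)
    (hTcMeet : ∀ A ∈ 𝒯, (Tc.verts ∩ A.verts).ncard = 1)
    (F : Set (Sym2 V))
    (hF : ∀ e ∈ F, ∃ A ∈ 𝒯, ∃ B ∈ 𝒯, A ≠ B ∧ ∃ u w : V, u ≠ w ∧ e = s(u, w) ∧
      u ∈ A.verts ∧ w ∈ B.verts)
    (T' : (⊤ : SimpleGraph V).Subgraph) (hT' : T'.coe.IsTree)
    (hT'v : T'.verts = ⋃ A ∈ 𝒯, A.verts)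
    (hT'e : T'.edgeSet = F ∪ ⋃ A ∈ 𝒯, A.edgeSet)
    (e e' : Sym2 V) (hrepl : IsReplacementPair T' e e') :
    IsReplacementPair T e e' ∨ e' ∈ F ∨
      ∃ f ∈ F, IsReplacementPair T' e f ∧ IsReplacementPair T f e' := by
  obtain ⟨u, v, huv, rfl, hu, hv, he', p, hp, hep⟩ := hrepl
  by_cases heF : e' ∈ F
  · exact .inr (.inl heF)
  have mem_edgeSet : ∀ g ∈ T'.edgeSet, g ∉ F → g ∈ T.edgeSet := by
    intro g hg hgF
    rw [hT'e] at hg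
    obtain ⟨A, hA, hgA⟩ := Set.mem_iUnion₂.mp (hg.resolve_left hgF)
    exact Subgraph.edgeSet_mono (h𝒯sub A hA).1 hgA
  have mem_verts : ∀ x ∈ T'.verts, x ∈ T.verts := by
    intro x hx
    rw [hT'v] at hx
    obtain ⟨A, hA, hxA⟩ := Set.mem_iUnion₂.mp hx
    exact (h𝒯sub A hA).1.1 hxA
  have edges_subset : ∀ {H : (⊤ : SimpleGraph V).Subgraph} {x y : V}
      (q : H.spanningCoe.Walk x y), ∀ g ∈ q.edges, g ∈ H.edgeSet := fun {H} _ _ q g hg =>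
    H.edgeSet_spanningCoe ▸ q.edges_subset_edgeSet hg
  have heT := mem_edgeSet e' he' heF
  induction e' with | h a b =>
  obtain ⟨P, hPab, hP⟩ := Subgraph.exists_separation_of_isAcyclic hT.isAcyclic heT
  have isReplacementPair_of_separated : ∀ x y, x ∈ T.verts → y ∈ T.verts → ¬(P x ↔ P y) →
      IsReplacementPair T s(x, y) s(a, b) := by
    intro x y hx hy hxy
    obtain ⟨q, hq⟩ := ((hT.connected ⟨x, hx⟩ ⟨y, hy⟩).map
      T.coeEmbeddingSpanningCoe.toHom).exists_isPath
    refine ⟨x, y, fun h => hxy (h ▸ Iff.rfl), rfl, hx, hy, heT, q, hq, ?_⟩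
    by_contra hmem
    exact hxy (q.iff_of_forall_edges_iff fun z w hzw =>
      hP z w (edges_subset q _ hzw) fun hc => hmem (hc ▸ hzw))
  by_cases hPuv : P u ↔ P v
  · obtain ⟨x, y, hxy, hne, hPxy⟩ :
        ∃ x y, s(x, y) ∈ p.edges ∧ s(x, y) ≠ s(a, b) ∧ ¬(P x ↔ P y) := by
      by_contra! hall
      exact hp.isTrail.not_iff_of_unique_edge hep hPab (fun x y h hne => by
        have := hall x y h hne
        tauto) hPuv
    have hxyT' : T'.Adj x y := edges_subset p _ hxy
    have hxyF : s(x, y) ∈ F := by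
      by_contra hF'
      exact hPxy (hP x y (mem_edgeSet _ hxyT' hF') hne)
    exact .inr (.inr ⟨s(x, y), hxyF, ⟨u, v, huv, rfl, hu, hv, hxyT', p, hp, hxy⟩,
      isReplacementPair_of_separated x y (mem_verts x hxyT'.fst_mem)
        (mem_verts y hxyT'.snd_mem) hPxy⟩)
  · exact .inl (isReplacementPair_of_separated u v (mem_verts u hu) (mem_verts v hv) hPuv)
end

section
/- Let τ ≥ 0 and let T be a tree whose vertex set is contained in the vertex set V of a complete weighted graph GD = (V, binom(V,2), d_GD), such that T does not admit any τ-efficient replacement pair. Let v ∈ V(T), let T_1, …, T_s be the connected components of T \ {v}, let F^v be the reconnecting edges for v, and let T' = (T \ {v}) ∪ F^v be the reconnected tree. Then T' does not admit any τ-efficient replacement pair either. -/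
open SimpleGraph

namespace SimpleGraph

theorem Reachable.of_forall_adj {V W : Type*} {G : SimpleGraph V} {H : SimpleGraph W}
    (f : V → W) (hf : ∀ x y, G.Adj x y → H.Reachable (f x) (f y)) {x y : V}
    (h : G.Reachable x y) : H.Reachable (f x) (f y) := by
  obtain ⟨p⟩ := h
  induction p with
  | nil => rfl
  | cons hadj _ ih => exact (hf _ _ hadj).trans ih

theorem reachable_deleteEdges_of_notMem_edges {V : Type*} {G : SimpleGraph V} {x y : V}
    {e : Sym2 V} (p : G.Walk x y) (he : e ∉ p.edges) : (G.deleteEdges {e}).Reachable x y := by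
  by_contra h
  exact he (p.mem_edges_of_not_reachable_deleteEdges h)

/-- In an acyclic graph, deleting an edge of a path separates the endpoints of the path. -/
theorem IsAcyclic.not_reachable_deleteEdges_of_mem_edges {V : Type*} {G : SimpleGraph V}
    (hG : G.IsAcyclic) {x y : V} {p : G.Walk x y} (hp : p.IsPath) {e : Sym2 V}
    (he : e ∈ p.edges) : ¬ (G.deleteEdges {e}).Reachable x y := by
  intro h
  obtain ⟨q, hq⟩ := h.exists_isPath
  have hq' : (q.mapLe (G.deleteEdges_le {e})).IsPath := Walk.IsPath.mapLe _ hq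
  have hpq : p = q.mapLe (G.deleteEdges_le {e}) :=
    congrArg Subtype.val ((hG.subsingleton_path _ _).elim ⟨p, hp⟩ ⟨_, hq'⟩)
  rw [hpq, Walk.edges_mapLe_eq_edges] at he
  simpa using q.edges_subset_edgeSet he

/-- In an acyclic graph, two vertices connected in a subgraph which are not separated by deleting
an edge of the graph are not separated by deleting this edge from the subgraph. -/
theorem IsAcyclic.reachable_deleteEdges_of_le {V : Type*} {G H : SimpleGraph V}
    (hG : G.IsAcyclic) (hHG : H ≤ G) {x y : V} {e : Sym2 V} (hH : H.Reachable x y)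
    (h : (G.deleteEdges {e}).Reachable x y) : (H.deleteEdges {e}).Reachable x y := by
  obtain ⟨p, hp⟩ := hH.exists_isPath
  refine reachable_deleteEdges_of_notMem_edges p fun he => ?_
  exact hG.not_reachable_deleteEdges_of_mem_edges (Walk.IsPath.mapLe hHG hp)
    (by rwa [Walk.edges_mapLe_eq_edges]) h

/-- Exchanging an edge of the tree path between two vertices for the edge joining these vertices
yields a tree. -/
theorem IsTree.deleteEdges_sup_edge {V : Type*} {M : SimpleGraph V} (hM : M.IsTree) {a b : V}
    (hab : a ≠ b) {p : M.Walk a b} (hp : p.IsPath) {f : Sym2 V} (hf : f ∈ p.edges) :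
    (M.deleteEdges {f} ⊔ edge a b).IsTree := by
  have hnr := hM.isAcyclic.not_reachable_deleteEdges_of_mem_edges hp hf
  refine ⟨?_, (hM.isAcyclic.anti (M.deleteEdges_le {f})).sup_edge_of_not_reachable hnr⟩
  have hadj : (M.deleteEdges {f} ⊔ edge a b).Adj a b := Or.inr (by simp [edge_adj, hab])
  have hne : Nonempty V := ⟨a⟩
  refine ⟨fun x y => ?_⟩
  refine Reachable.of_forall_adj (G := M) id (fun x y hxy => ?_) (hM.connected.preconnected x y)
  by_cases hxyf : s(x, y) = f
  · subst hxyf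
    by_cases hxyab : s(x, y) = s(a, b)
    · refine Adj.reachable ((mem_edgeSet _).1 ?_)
      simpa only [id, hxyab, mem_edgeSet] using hadj
    have hsub : M ≤ M ⊔ edge a b := le_sup_left
    have hba : (M ⊔ edge a b).Adj b a := Or.inr (by simp [edge_adj, hab.symm])
    have hbap : s(b, a) ∉ (p.mapLe hsub).edges := by
      rw [Walk.edges_mapLe_eq_edges, Sym2.eq_swap]
      intro h
      exact hnr (Adj.reachable (by
        rw [deleteEdges_adj]
        exact ⟨p.adj_of_mem_edges h, fun h => hxyab h.symm⟩))
    have hcyc := (adj_and_reachable_delete_edges_iff_exists_cycle (v := x) (w := y)).2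
      ⟨b, Walk.cons hba (p.mapLe hsub),
        (Walk.cons_isCycle_iff _ _).2 ⟨Walk.IsPath.mapLe hsub hp, hbap⟩, by simp [hf]⟩
    refine hcyc.2.mono ?_
    rw [deleteEdges_sup]
    exact sup_le_sup_left (deleteEdges_le _) _
  · exact Adj.reachable (Or.inl (by simp [hxy, hxyf]))

/-- A minimum spanning tree of a complete graph is a bottleneck spanning tree: every edge on the
tree path between two vertices weighs at most as much as the edge joining them. -/
theorem IsTree.weight_le_of_mem_edges {V : Type*} [Finite V] {M : SimpleGraph V} (hM : M.IsTree)
    (c : Sym2 V → ℝ)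
    (hmin : ∀ M' : SimpleGraph V, M'.IsTree → ∑ᶠ f ∈ M.edgeSet, c f ≤ ∑ᶠ f ∈ M'.edgeSet, c f)
    {a b : V} (hab : a ≠ b) {p : M.Walk a b} (hp : p.IsPath) {f : Sym2 V} (hf : f ∈ p.edges) :
    c f ≤ c s(a, b) := by
  have hnr := hM.isAcyclic.not_reachable_deleteEdges_of_mem_edges hp hf
  have hfM : f ∈ M.edgeSet := p.edges_subset_edgeSet hf
  have h1 : M.edgeSet = insert f (M.edgeSet \ {f}) := by simp [Set.insert_eq_of_mem hfM]
  have h2 : (M.deleteEdges {f} ⊔ edge a b).edgeSet = insert s(a, b) (M.edgeSet \ {f}) := by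
    rw [edgeSet_sup, edgeSet_edge_of_ne hab, edgeSet_deleteEdges, Set.union_comm]
    rfl
  have h3 : s(a, b) ∉ M.edgeSet \ {f} := fun h => hnr (Adj.reachable (by simpa using h))
  have h := hmin _ (hM.deleteEdges_sup_edge hab hp hf)
  rw [h2, finsum_mem_insert _ h3 (Set.toFinite _), h1,
    finsum_mem_insert _ (by simp) (Set.toFinite _)] at h
  simpa using h

namespace Subgraph

variable {V : Type*} {G : SimpleGraph V} {H : G.Subgraph}

theorem isAcyclic_spanningCoe (hH : H.coe.IsAcyclic) : H.spanningCoe.IsAcyclic := by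
  intro u p hp
  have hs : ∀ x ∈ p.support, x ∈ H.verts := by
    intro x hx
    obtain ⟨e, he, hxe⟩ := (Walk.mem_support_iff_exists_mem_edges_of_not_nil hp.not_nil).1 hx
    have heH := p.edges_subset_edgeSet he
    rw [edgeSet_spanningCoe] at heH
    exact H.mem_verts_of_mem_edge heH hxe
  have hle : H.spanningCoe.induce H.verts ≤ H.coe := fun _ _ h => h
  refine hH ((p.induce _ hs).mapLe hle) (Walk.IsCycle.mapLe hle 
    (Walk.IsCycle.of_map (f := (Embedding.induce _).toHom) ?_))
  rwa [Walk.map_induce]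

theorem reachable_spanningCoe (hH : H.coe.Connected) {x y : V} (hx : x ∈ H.verts)
    (hy : y ∈ H.verts) : H.spanningCoe.Reachable x y :=
  (hH.preconnected ⟨x, hx⟩ ⟨y, hy⟩).map H.coeEmbeddingSpanningCoe.toHom

end Subgraph

end SimpleGraph

/-- Let `τ ≥ 0` and let `T` be a tree with vertices in the vertex set `V` of a
complete weighted graph `GD = (V, d)` admitting no `τ`-efficient replacement pair.
Let `v ∈ V(T)` and let `C 0, …, C (s-1)` be the connected components of `T` with `v`
(and its incident edges) removed.  For `i ≠ j` let `E i j` be an edge of minimum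
`d`-weight among the edges of `GD` between `V(C i)` and `V(C j)`; let `M` be a
minimum spanning tree of the auxiliary complete graph `H_v` on `{C 0, …, C (s-1)}`
in which the edge `{i, j}` has weight `d (E i j)`; the set of reconnecting edges is
`F^v = {E i j : {i, j} ∈ E(M)}`, and the reconnected tree `T'` has vertex set
`V(T) \ {v}` and edge set `F^v` together with the edges of the components `C i`.
Then `T'` admits no `τ`-efficient replacement pair either. -/
theorem stmt11 {V : Type*} [Fintype V]
    (d : Sym2 V → ℝ) (τ : ℝ) (hτ : 0 ≤ τ)
    (T : (⊤ : SimpleGraph V).Subgraph) (hT : T.coe.IsTree)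
    (hTno : ¬ ∃ e eT : Sym2 V, IsReplacementPair T e eT ∧ (1 + τ) * d e < d eT)
    (v : V) (hv : v ∈ T.verts)
    -- `C 0, …, C (s-1)` are the connected components of `T` with `v` removed:
    (s : ℕ) (C : Fin s → (⊤ : SimpleGraph V).Subgraph)
    (hCtree : ∀ i, (C i).coe.IsTree)
    (hCsub : ∀ i, C i ≤ T)
    (hCdisj : ∀ i j, i ≠ j → (C i).verts ∩ (C j).verts = ∅)
    (hCverts : (⋃ i, (C i).verts) = T.verts \ {v})
    (hCedges : (⋃ i, (C i).edgeSet) = {e : Sym2 V | e ∈ T.edgeSet ∧ v ∉ e})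
    -- minimum-weight edges of `GD` connecting the components:
    (E : Fin s → Fin s → Sym2 V)
    (hEsymm : ∀ i j, E i j = E j i)
    (hEconn : ∀ i j, i ≠ j → ∃ u w : V, u ≠ w ∧ E i j = s(u, w) ∧
      u ∈ (C i).verts ∧ w ∈ (C j).verts)
    (hEmin : ∀ i j, i ≠ j → ∀ u ∈ (C i).verts, ∀ w ∈ (C j).verts,
      d (E i j) ≤ d s(u, w))
    -- `M` is a minimum spanning tree of the auxiliary complete graph `H_v`:
    (M : SimpleGraph (Fin s)) (hM : M.IsTree)
    (hMmin : ∀ M' : SimpleGraph (Fin s), M'.IsTree →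
      (∑ᶠ f ∈ M.edgeSet,
          Sym2.lift ⟨fun i j => d (E i j), fun i j => congrArg d (hEsymm i j)⟩ f) ≤
        ∑ᶠ f ∈ M'.edgeSet,
          Sym2.lift ⟨fun i j => d (E i j), fun i j => congrArg d (hEsymm i j)⟩ f)
    -- the reconnected tree `T' = (T \ {v}) ∪ F^v`:
    (T' : (⊤ : SimpleGraph V).Subgraph)
    (hT'v : T'.verts = T.verts \ {v})
    (hT'e : T'.edgeSet =
      {f : Sym2 V | ∃ i j : Fin s, s(i, j) ∈ M.edgeSet ∧ f = E i j} ∪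
        ⋃ i, (C i).edgeSet) :
    ¬ ∃ e eT : Sym2 V, IsReplacementPair T' e eT ∧ (1 + τ) * d e < d eT := by
  rintro ⟨e, eT, ⟨u, w, huw, rfl, hu, hw, heT, p, hp, hpe⟩, hlt⟩
  have hpos : 0 < 1 + τ := by linarith
  have hTac : T.spanningCoe.IsAcyclic := Subgraph.isAcyclic_spanningCoe hT.isAcyclic
  have hidx : ∀ {x i j}, x ∈ (C i).verts → x ∈ (C j).verts → i = j := by
    intro x i j hi hj
    by_contra hij
    exact (hCdisj i j hij).subset ⟨hi, hj⟩
  have hmem : ∀ {x}, x ∈ T'.verts → ∃ i, x ∈ (C i).verts := by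
    intro x hx
    rwa [hT'v, ← hCverts, Set.mem_iUnion] at hx
  have hCT : ∀ {i x}, x ∈ (C i).verts → x ∈ T.verts := fun {i x} hx => (hCsub i).1 hx
  have hT'T : ∀ {x}, x ∈ T'.verts → x ∈ T.verts := fun {x} hx => (hT'v ▸ hx).1
  have hCT' : ∀ i, (C i).spanningCoe ≤ T'.spanningCoe := by
    intro i x y hxy
    change s(x, y) ∈ T'.edgeSet
    rw [hT'e]
    exact Or.inr (Set.mem_iUnion.2 ⟨i, hxy⟩)
  have hveT : v ∉ eT := fun h => (hT'v ▸ T'.mem_verts_of_mem_edge heT h).2 rfl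
  have hsep : ∀ {x y}, x ∈ T.verts → y ∈ T.verts → x ≠ y → (1 + τ) * d s(x, y) < d eT →
      (T.spanningCoe.deleteEdges {eT}).Reachable x y := by
    intro x y hx hy hxy hd
    obtain ⟨q, hq⟩ := (Subgraph.reachable_spanningCoe hT.connected hx hy).exists_isPath
    refine reachable_deleteEdges_of_notMem_edges q fun he => hTno ?_
    exact ⟨_, eT, ⟨x, y, hxy, rfl, hx, hy, by simpa using q.edges_subset_edgeSet he, q, hq, he⟩, hd⟩
  have hout : ∀ {k}, eT ∉ (C k).edgeSet → ∀ {x}, x ∈ (C k).verts →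
      (T.spanningCoe.deleteEdges {eT}).Reachable x v := by
    intro k hk x hx
    obtain ⟨q⟩ := Subgraph.reachable_spanningCoe hT.connected (hCT hx) hv
    induction q with
    | nil => rfl
    | @cons x y z hxy q ih =>
      have hxyT : s(x, y) ∈ T.edgeSet := hxy
      by_cases hz : z ∈ s(x, y)
      · rcases Sym2.mem_iff.1 hz with rfl | rfl
        · rfl
        · exact Adj.reachable (by
            rw [deleteEdges_adj]
            exact ⟨hxy, fun h => hveT (h ▸ hz)⟩)
      · have hxyC : s(x, y) ∈ ⋃ i, (C i).edgeSet := hCedges ▸ ⟨hxyT, hz⟩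
        obtain ⟨j, hj⟩ := Set.mem_iUnion.1 hxyC
        obtain rfl := hidx ((C j).mem_verts_of_mem_edge hj (Sym2.mem_mk_left x y)) hx
        refine Reachable.trans (Adj.reachable ?_)
          (ih hv hCverts hCedges hT'v hveT ((C j).mem_verts_of_mem_edge hj (Sym2.mem_mk_right x y)))
        rw [deleteEdges_adj]
        exact ⟨hxy, fun h => hk (h ▸ hj)⟩
  have hstay : ∀ {k}, eT ∉ (C k).edgeSet → ∀ {x y}, x ∈ (C k).verts → y ∈ (C k).verts →
      (T.spanningCoe.deleteEdges {eT}).Reachable x y :=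
    fun {k} hk {x y} hx hy => (hout hk hx).trans (hout hk hy).symm
  have huniq : ∀ {i k}, eT ∈ (C i).edgeSet → k ≠ i → eT ∉ (C k).edgeSet := by
    intro i k hi hki hk
    exact hki (hidx ((C k).mem_verts_of_mem_edge hk eT.out_fst_mem)
      ((C i).mem_verts_of_mem_edge hi eT.out_fst_mem))
  have hin : ∀ {k x y}, x ∈ (C k).verts → y ∈ (C k).verts →
      (T.spanningCoe.deleteEdges {eT}).Reachable x y →
      (T'.spanningCoe.deleteEdges {eT}).Reachable x y := by
    intro k x y hx hy h
    exact (hTac.reachable_deleteEdges_of_le (Subgraph.spanningCoe_le_of_le (hCsub k))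
      (Subgraph.reachable_spanningCoe (hCtree k).connected hx hy) h).mono
      (deleteEdges_mono (hCT' k))
  have hlift : ∀ {a b} (q : M.Walk a b),
      (∀ j k, s(j, k) ∈ q.edges → E j k ≠ eT ∧ d (E j k) ≤ d s(u, w)) →
      ∀ {x y}, x ∈ (C a).verts → y ∈ (C b).verts →
      (T.spanningCoe.deleteEdges {eT}).Reachable x y →
      (T'.spanningCoe.deleteEdges {eT}).Reachable x y := by
    intro a b q
    induction q with
    | nil => exact fun _ _ _ hx hy h => hin hx hy h
    | @cons a c b hac q ih =>
      intro hq x y hx hy h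
      by_cases hab : a = b
      · subst hab
        exact hin hx hy h
      obtain ⟨hne, hd⟩ := hq a c (by simp)
      obtain ⟨x', y', hxy', hE, hx', hy'⟩ := hEconn a c hac.ne
      rw [hE] at hd
      have h1 := hsep (hCT hx') (hCT hy') hxy'
        ((mul_le_mul_of_nonneg_left hd hpos.le).trans_lt hlt)
      have h2 : (T.spanningCoe.deleteEdges {eT}).Reachable x x' := by
        by_cases ha : eT ∈ (C a).edgeSet
        · exact h.trans ((hout (huniq ha (Ne.symm hab)) hy).trans
            ((hout (huniq ha hac.ne') hy').symm.trans h1.symm))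
        · exact hstay ha hx hx'
      have h3 : (T'.spanningCoe.deleteEdges {eT}).Adj x' y' := by
        rw [deleteEdges_adj]
        refine ⟨?_, fun h => hne (hE.trans h)⟩
        change s(x', y') ∈ T'.edgeSet
        rw [hT'e]
        exact Or.inl ⟨a, c, hac, hE.symm⟩
      exact (hin hx hx' h2).trans (h3.reachable.trans
        (ih (fun j k hjk => hq j k (by simp [hjk])) hy' hy
          (h1.symm.trans (h2.symm.trans h))))
  have hT'ac : T'.spanningCoe.IsAcyclic := by
    classical
    obtain ⟨i₀⟩ := hM.connected.nonempty
    let π : V → Fin s := fun x => if hx : ∃ i, x ∈ (C i).verts then hx.choose else i₀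
    have hπ : ∀ {x i}, x ∈ (C i).verts → π x = i := by
      intro x i hx
      have hex : ∃ i, x ∈ (C i).verts := ⟨i, hx⟩
      simp only [π, dif_pos hex]
      exact hidx hex.choose_spec hx
    have hbridge : ∀ i j, M.Adj i j → T'.spanningCoe.IsBridge (E i j) := by
      intro i j hij
      obtain ⟨x, y, -, hE, hx, hy⟩ := hEconn i j hij.ne
      rw [hE, isBridge_iff]
      intro h
      have hMb := (isAcyclic_iff_forall_adj_isBridge.1 hM.isAcyclic) hij
      rw [isBridge_iff] at hMb
      rw [← hπ hx, ← hπ hy] at hMb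
      refine hMb (h.of_forall_adj π fun x' y' hxy' => ?_)
      rw [hπ hx, hπ hy]
      rw [deleteEdges_adj] at hxy'
      obtain ⟨hadj, hne⟩ := hxy'
      change s(x', y') ∈ T'.edgeSet at hadj
      rw [hT'e] at hadj
      rcases hadj with ⟨k, l, hkl, hEkl⟩ | hadj
      · obtain ⟨x₁, y₁, -, hE₁, hx₁, hy₁⟩ := hEconn k l (M.ne_of_adj hkl)
        have hkl' : (M.deleteEdges {s(i, j)}).Adj k l := by
          rw [deleteEdges_adj]
          refine ⟨hkl, fun h => hne ?_⟩
          rw [Set.mem_singleton_iff, hEkl, ← hE]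
          rcases Sym2.eq_iff.1 h with ⟨rfl, rfl⟩ | ⟨rfl, rfl⟩
          · rfl
          · exact hEsymm _ _
        rcases Sym2.eq_iff.1 (hEkl.trans hE₁) with ⟨rfl, rfl⟩ | ⟨rfl, rfl⟩
        · rw [hπ hx₁, hπ hy₁]
          exact hkl'.reachable
        · rw [hπ hx₁, hπ hy₁]
          exact hkl'.reachable.symm
      · obtain ⟨k, hk⟩ := Set.mem_iUnion.1 hadj
        have hk' : (C k).Adj x' y' := hk
        rw [hπ hk'.fst_mem, hπ hk'.snd_mem]
    intro x c hc
    have hcT : ∀ f ∈ c.edges, f ∈ T.spanningCoe.edgeSet := by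
      intro f hf
      have hfT' : f ∈ T'.edgeSet := by simpa using c.edges_subset_edgeSet hf
      rw [hT'e] at hfT'
      rcases hfT' with ⟨i, j, hij, rfl⟩ | hfT'
      · exact absurd hf ((hbridge i j hij).notMem_edges_of_isCycle hc)
      · rw [hCedges] at hfT'
        simpa using hfT'.1
    exact hTac (c.transfer _ hcT) (hc.transfer hcT)
  have hdeT : ¬ d eT ≤ d s(u, w) := by
    intro hle
    have hneg : τ * d s(u, w) < 0 := by linarith
    obtain ⟨q, hq⟩ :=
      (Subgraph.reachable_spanningCoe hT.connected (hT'T hu) (hT'T hw)).exists_isPath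
    cases q with
    | nil => exact huw rfl
    | @cons _ y _ huy q =>
      have huyT : T.Adj u y := huy
      have h1 : ¬ (1 + τ) * d s(u, w) < d s(u, y) := fun h => hTno
        ⟨_, _, ⟨u, w, huw, rfl, hT'T hu, hT'T hw, huyT, _, hq, by simp⟩, h⟩
      have h2 : ¬ (1 + τ) * d s(u, y) < d s(u, y) := fun h => hTno
        ⟨_, _, ⟨u, y, huyT.ne, rfl, hT'T hu, huyT.snd_mem, huyT, huy.toWalk,
          Walk.IsPath.of_adj huy, by simp⟩, h⟩
      have hdneg : d s(u, w) < 0 := by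
        by_contra! h
        exact hneg.not_ge (mul_nonneg hτ h)
      have hτpos : 0 < τ := hτ.lt_of_ne (by rintro rfl; simp at hneg)
      have h3 : (1 + τ) * d s(u, w) < 0 := mul_neg_of_pos_of_neg hpos hdneg
      have h4 : τ * d s(u, y) < 0 := mul_neg_of_pos_of_neg hτpos (by linarith)
      linarith
  obtain ⟨a, ha⟩ := hmem hu
  obtain ⟨b, hb⟩ := hmem hw
  obtain ⟨q, hq⟩ := (hM.connected.preconnected a b).exists_isPath
  refine hT'ac.not_reachable_deleteEdges_of_mem_edges hp hpe
    (hlift q (fun j k hjk => ?_) ha hb (hsep (hT'T hu) (hT'T hw) huw hlt))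
  have hab : a ≠ b := by
    rintro rfl
    rw [Walk.edges_eq_nil.2 (Walk.isPath_iff_nil.1 hq)] at hjk
    simp at hjk
  have hle : d (E j k) ≤ d s(u, w) :=
    (hM.weight_le_of_mem_edges _ hMmin hab hq hjk).trans (hEmin a b hab u ha w hb)
  exact ⟨fun h => hdeT (h ▸ hle), hle⟩
end

section
/- Let B be a bipartite emulator of a finite connected weighted graph G with stretch α ≥ 1. Then for any nonempty set of terminals S ⊆ V(G) it holds that d̃_B(MST(G̃[S])) ≤ 2α · d_G(ST(G,S)), where MST(G̃[S]) is a minimum-weight spanning tree of the complete graph G̃ restricted to S, and ST(G,S) is a minimum-weight Steiner tree of S in G. -/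
open SimpleGraph

/-- The shortest-path distance between `u` and `v` in the graph `G` with edge
weights `w`. -/
noncomputable def spDist {α : Type*} (G : SimpleGraph α) (w : Sym2 α → ℝ)
    (u v : α) : ℝ :=
  sInf {x | ∃ p : G.Walk u v, x = (p.edges.map w).sum}

/-- The total weight of the edges of a subgraph of a graph `G`. -/
noncomputable def gsubWeight {α : Type*} {G : SimpleGraph α} (w : Sym2 α → ℝ)
    (H : G.Subgraph) : ℝ :=
  ∑ᶠ e ∈ H.edgeSet, w e

/-- `d̃_B` : the weight on unordered pairs of vertices of `G` given by
`d̃_B(u,v) = min_{x ∈ N} (d_B(u x) + d_B(x v))`, the minimum taken over auxiliary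
vertices `x` adjacent in `B` to both `u` and `v`. -/
noncomputable def emuDist {V N : Type*} (B : SimpleGraph (V ⊕ N))
    (dB : Sym2 (V ⊕ N) → ℝ) : Sym2 V → ℝ :=
  fun e => sInf {r | ∃ (u v : V) (x : N), e = s(u, v) ∧
    B.Adj (Sum.inl u) (Sum.inr x) ∧ B.Adj (Sum.inr x) (Sum.inl v) ∧
    r = dB s(Sum.inl u, Sum.inr x) + dB s(Sum.inr x, Sum.inl v)}

/-- `B` (with weights `dB`) is a bipartite emulator of `G` (with weights `wG`) of
stretch `α`: `B` is a bipartite graph on `V(G) ⊎ N` with nonnegative edge weights,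
distances in `B` do not underestimate distances in `G`, and for every pair
`u, v ∈ V(G)` there is an auxiliary vertex `x ∈ N` with
`dB(u x) + dB(x v) ≤ α · δ_G(u, v)`. -/
def IsBipartiteEmulator {V N : Type*} (G : SimpleGraph V) (wG : Sym2 V → ℝ)
    (B : SimpleGraph (V ⊕ N)) (dB : Sym2 (V ⊕ N) → ℝ) (α : ℝ) : Prop :=
  (∀ u v : V, ¬ B.Adj (Sum.inl u) (Sum.inl v)) ∧
  (∀ x y : N, ¬ B.Adj (Sum.inr x) (Sum.inr y)) ∧
  (∀ e ∈ B.edgeSet, 0 ≤ dB e) ∧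
  (∀ u v : V, spDist G wG u v ≤ spDist B dB (Sum.inl u) (Sum.inl v)) ∧
  (∀ u v : V, ∃ x : N, B.Adj (Sum.inl u) (Sum.inr x) ∧ B.Adj (Sum.inr x) (Sum.inl v) ∧
    dB s(Sum.inl u, Sum.inr x) + dB s(Sum.inr x, Sum.inl v) ≤ α * spDist G wG u v)

/-- The total weight of the edges of a walk. -/
def SimpleGraph.Walk.edgeWeight {V : Type*} {G : SimpleGraph V} (w : Sym2 V → ℝ) {u v : V}
    (p : G.Walk u v) : ℝ :=
  (p.edges.map w).sum

lemma SimpleGraph.Walk.edgeWeight_nonneg {V : Type*} {G : SimpleGraph V} {w : Sym2 V → ℝ}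
    (hw : ∀ e ∈ G.edgeSet, 0 ≤ w e) {u v : V} (p : G.Walk u v) : 0 ≤ p.edgeWeight w := by
  refine List.sum_nonneg fun x hx => ?_
  obtain ⟨e, he, rfl⟩ := List.mem_map.1 hx
  exact hw e (p.edges_subset_edgeSet he)

lemma spDist_le_edgeWeight {V : Type*} {G : SimpleGraph V} {w : Sym2 V → ℝ}
    (hw : ∀ e ∈ G.edgeSet, 0 ≤ w e) {u v : V} (p : G.Walk u v) :
    spDist G w u v ≤ p.edgeWeight w := by
  refine csInf_le ⟨0, ?_⟩ ⟨p, rfl⟩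
  rintro x ⟨q, rfl⟩
  exact q.edgeWeight_nonneg hw

lemma finsum_mem_le_finsum_mem_of_subset {ι : Type*} [Finite ι] {f : ι → ℝ} {s t : Set ι}
    (hst : s ⊆ t) (hf : ∀ i ∈ t, 0 ≤ f i) : ∑ᶠ i ∈ s, f i ≤ ∑ᶠ i ∈ t, f i := by
  rw [finsum_mem_eq_finite_toFinset_sum f s.toFinite,
    finsum_mem_eq_finite_toFinset_sum f t.toFinite]
  exact Finset.sum_le_sum_of_subset_of_nonneg (by simpa using hst)
    fun i hi _ => hf i (by simpa using hi)

lemma finsum_mem_union_singleton_le {ι : Type*} [Finite ι] {f : ι → ℝ} (s : Set ι) {i : ι}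
    (hi : 0 ≤ f i) : ∑ᶠ j ∈ s ∪ {i}, f j ≤ ∑ᶠ j ∈ s, f j + f i := by
  by_cases h : i ∈ s
  · rw [Set.union_eq_self_of_subset_right (by simpa using h)]
    linarith
  · rw [Set.union_singleton, finsum_mem_insert f h s.toFinite, add_comm]

lemma nonneg_of_mem_emuDist_values {V N : Type*} {B : SimpleGraph (V ⊕ N)} {dB : Sym2 (V ⊕ N) → ℝ}
    (hd : ∀ e ∈ B.edgeSet, 0 ≤ dB e) (e : Sym2 V) :
    ∀ r ∈ {r | ∃ (u v : V) (x : N), e = s(u, v) ∧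
      B.Adj (Sum.inl u) (Sum.inr x) ∧ B.Adj (Sum.inr x) (Sum.inl v) ∧
      r = dB s(Sum.inl u, Sum.inr x) + dB s(Sum.inr x, Sum.inl v)}, 0 ≤ r := by
  rintro r ⟨u, v, x, -, h₁, h₂, rfl⟩
  exact add_nonneg (hd _ h₁) (hd _ h₂)

/-- In a bipartite emulator, `d̃_B(u, v)` is at most `α` times the weight of any walk from `u` to
`v` in the emulated graph. -/
lemma IsBipartiteEmulator.emuDist_le {V N : Type*} {G : SimpleGraph V} {wG : Sym2 V → ℝ}
    {B : SimpleGraph (V ⊕ N)} {dB : Sym2 (V ⊕ N) → ℝ} {α : ℝ}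
    (hB : IsBipartiteEmulator G wG B dB α) (hw : ∀ e ∈ G.edgeSet, 0 ≤ wG e) (hα : 0 ≤ α)
    {u v : V} (p : G.Walk u v) : emuDist B dB s(u, v) ≤ α * p.edgeWeight wG := by
  obtain ⟨-, -, hd, -, hx⟩ := hB
  obtain ⟨x, h₁, h₂, hle⟩ := hx u v
  calc emuDist B dB s(u, v) ≤ dB s(Sum.inl u, Sum.inr x) + dB s(Sum.inr x, Sum.inl v) :=
        csInf_le ⟨0, nonneg_of_mem_emuDist_values hd _⟩ ⟨u, v, x, rfl, h₁, h₂, rfl⟩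
    _ ≤ α * spDist G wG u v := hle
    _ ≤ α * p.edgeWeight wG := mul_le_mul_of_nonneg_left (spDist_le_edgeWeight hw p) hα

/-- Every connected subgraph has a closed walk that visits all its vertices and whose weight is at
most twice the weight of the subgraph. -/
lemma exists_closed_walk_edgeWeight_le {V : Type*} [Finite V] {G : SimpleGraph V}
    {w : Sym2 V → ℝ} (hw : ∀ e ∈ G.edgeSet, 0 ≤ w e) (H : G.Subgraph) (hH : H.Connected) :
    ∃ (r : V) (p : G.Walk r r), H.verts ⊆ {v | v ∈ p.support} ∧
      p.edgeWeight w ≤ 2 * gsubWeight w H := by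
  obtain ⟨r, hr⟩ := hH.nonempty
  let P : Set (Set V) := {A | A ⊆ H.verts ∧ ∃ p : G.Walk r r, {v | v ∈ p.support} = A ∧
    p.edgeWeight w ≤ 2 * ∑ᶠ e ∈ {e | e ∈ H.edgeSet ∧ ∀ v ∈ e, v ∈ A}, w e}
  have hP : {r} ∈ P := by
    refine ⟨by simpa using hr, Walk.nil, by ext; simp, ?_⟩
    simp only [Walk.edgeWeight, Walk.edges_nil, List.map_nil, List.sum_nil]
    exact mul_nonneg zero_le_two (finsum_nonneg fun e => finsum_nonneg fun he =>
      hw e (H.edgeSet_subset he.1))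
  obtain ⟨A, ⟨hAH, p, hpA, hp⟩, hmax⟩ := P.toFinite.exists_maximal ⟨_, hP⟩
  have hrA : r ∈ A := hpA ▸ p.start_mem_support
  have hHA : H.verts ⊆ A := by
    intro b hb
    by_contra hbA
    obtain ⟨q⟩ := hH.preconnected ⟨r, hr⟩ ⟨b, hb⟩
    obtain ⟨⟨⟨x, y⟩, hxy⟩, -, hx, hy⟩ := q.exists_boundary_dart {v | (v : V) ∈ A} hrA hbA
    obtain ⟨x, hxH⟩ := x
    obtain ⟨y, hyH⟩ := y
    change x ∈ A at hx
    change y ∉ A at hy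
    have hxy : H.Adj x y := hxy
    have hxp : x ∈ p.support := by rw [← hpA] at hx; exact hx
    obtain ⟨p₁, p₂, rfl⟩ := Walk.mem_support_iff_exists_append.1 hxp
    refine hy (hmax (y := insert y A) ⟨Set.insert_subset hyH hAH,
      p₁.append (Walk.cons hxy.adj_sub (Walk.cons hxy.adj_sub.symm p₂)), ?_, ?_⟩
      (Set.subset_insert _ _) (Set.mem_insert _ _))
    · rw [← hpA]
      ext v
      simp only [Walk.mem_support_append_iff, Walk.support_cons, List.mem_cons,
        Set.mem_insert_iff, Set.mem_ofPred_eq]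
      have := p₂.start_mem_support
      grind
    · have hsub : insert s(x, y) {e | e ∈ H.edgeSet ∧ ∀ v ∈ e, v ∈ A} ⊆
          {e | e ∈ H.edgeSet ∧ ∀ v ∈ e, v ∈ insert y A} := by
        refine Set.insert_subset ⟨hxy, ?_⟩ fun e he => ⟨he.1, fun v hv => Or.inr (he.2 v hv)⟩
        simp [hx]
      have hle := finsum_mem_le_finsum_mem_of_subset (f := w) hsub
        fun e he => hw e (H.edgeSet_subset he.1)
      rw [finsum_mem_insert w (fun h => hy (h.2 y (by simp))) (Set.toFinite _)] at hle
      simp only [Walk.edgeWeight, Walk.edges_append, Walk.edges_cons, List.map_append,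
        List.map_cons, List.sum_append, List.sum_cons, Sym2.eq_swap (a := y)] at hp ⊢
      linarith
  refine ⟨r, p, hHA.trans hpA.ge, hp.trans ?_⟩
  exact mul_le_mul_of_nonneg_left (finsum_mem_le_finsum_mem_of_subset (fun e he => he.1)
    fun e he => hw e (H.edgeSet_subset he)) zero_le_two

/-- Shortcutting a walk: the vertices of `A` on a walk are joined by a connected subgraph of the
complete graph of weight at most `α` times that of the walk. -/
lemma exists_connected_subWeight_add_le {V : Type*} [Finite V] {G : SimpleGraph V}
    {w d : Sym2 V → ℝ} {α : ℝ} (hw : ∀ e ∈ G.edgeSet, 0 ≤ w e) (hα : 0 ≤ α) (hd : ∀ e, 0 ≤ d e)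
    (hdw : ∀ {u v : V} (p : G.Walk u v), d s(u, v) ≤ α * p.edgeWeight w)
    {u v : V} (p : G.Walk u v) (A : Set V) (hA : A.Nonempty) (hAp : A ⊆ {x | x ∈ p.support}) :
    ∃ H : (⊤ : SimpleGraph V).Subgraph, H.Connected ∧ H.verts = A ∧
      ∃ a ∈ A, ∃ q : G.Walk u a, subWeight d H + α * q.edgeWeight w ≤ α * p.edgeWeight w := by
  have single {u v : V} (p : G.Walk u v) :
      ∃ H : (⊤ : SimpleGraph V).Subgraph, H.Connected ∧ H.verts = {u} ∧
      ∃ a ∈ ({u} : Set V), ∃ q : G.Walk u a,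
        subWeight d H + α * q.edgeWeight w ≤ α * p.edgeWeight w := by
    refine ⟨_, Subgraph.singletonSubgraph_connected (v := u), rfl, u, rfl, Walk.nil, ?_⟩
    simpa [subWeight, Walk.edgeWeight] using mul_nonneg hα (p.edgeWeight_nonneg hw)
  induction p generalizing A with
  | nil =>
    obtain rfl := (Set.Nonempty.subset_singleton_iff hA).1 (by simpa using hAp)
    exact single _
  | @cons u u' v h p ih =>
    by_cases hAu : (A \ {u}).Nonempty
    · obtain ⟨H, hHc, hHv, a, ha, q, hq⟩ := ih (A \ {u}) hAu fun x hx => by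
        have := hAp hx.1
        simpa [hx.2, show x ≠ u from hx.2] using this
      have hcons {t : V} (q : G.Walk u' t) :
          (Walk.cons h q).edgeWeight w = w s(u, u') + q.edgeWeight w := by
        simp [Walk.edgeWeight]
      by_cases hu : u ∈ A
      · have hua : (⊤ : SimpleGraph V).Adj u a := fun e => ha.2 e.symm
        refine ⟨H ⊔ (⊤ : SimpleGraph V).subgraphOfAdj hua,
          Subgraph.connected_sup hHc.preconnected
            (Subgraph.subgraphOfAdj_connected hua).preconnected ⟨a, by rw [hHv]; exact ha, by simp⟩,
          ?_, u, hu, Walk.nil, ?_⟩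
        · rw [Subgraph.verts_sup, hHv, subgraphOfAdj_verts]
          ext x
          have := ha.1
          simp only [Set.mem_union, Set.mem_sdiff, Set.mem_singleton_iff, Set.mem_insert_iff]
          grind
        · have h₁ : subWeight d (H ⊔ (⊤ : SimpleGraph V).subgraphOfAdj hua) ≤
              subWeight d H + d s(u, a) := by
            simp only [subWeight, Subgraph.edgeSet_sup, edgeSet_subgraphOfAdj]
            exact finsum_mem_union_singleton_le _ (hd _)
          have h₂ := hdw (Walk.cons h q)
          rw [hcons] at h₂ ⊢
          simp only [Walk.edgeWeight, Walk.edges_nil, List.map_nil, List.sum_nil] at *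
          linarith
      · refine ⟨H, hHc, by rw [hHv, Set.sdiff_singleton_eq_self hu], a, ha.1, Walk.cons h q, ?_⟩
        rw [hcons, hcons]
        linarith
    · obtain rfl := (Set.Nonempty.subset_singleton_iff hA).1
        (Set.sdiff_eq_empty.1 (Set.not_nonempty_iff_eq_empty.1 hAu))
      exact single _

lemma SimpleGraph.Subgraph.Connected.exists_isTree_le {V : Type*} {G : SimpleGraph V}
    {H : G.Subgraph} (hH : H.Connected) :
    ∃ T ≤ H, T.coe.IsTree ∧ T.verts = H.verts := by
  obtain ⟨F, hF, hFt⟩ := hH.coe.exists_isTree_le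
  let T : G.Subgraph :=
    { verts := H.verts
      Adj := fun u v => ∃ (hu : u ∈ H.verts) (hv : v ∈ H.verts), F.Adj ⟨u, hu⟩ ⟨v, hv⟩
      adj_sub := fun ⟨_, _, h⟩ => H.adj_sub (hF h)
      edge_vert := fun ⟨hu, _, _⟩ => hu
      symm := ⟨fun _ _ ⟨hu, hv, h⟩ => ⟨hv, hu, h.symm⟩⟩ }
  have hT : T.coe = F := by
    ext ⟨u, hu⟩ ⟨v, hv⟩
    exact ⟨fun ⟨_, _, h⟩ => h, fun h => ⟨hu, hv, h⟩⟩
  exact ⟨T, ⟨subset_rfl, fun _ _ ⟨_, _, h⟩ => hF h⟩, hT ▸ hFt, rfl⟩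

/-- Let `B` be a bipartite emulator of a finite connected weighted graph `G` with
stretch `α ≥ 1`, and `S ⊆ V(G)` nonempty.  Let `T = MST(G̃[S])` be a minimum-weight
spanning tree of the complete graph `G̃` (with weights `d̃_B`) restricted to `S`, and
let `ST` be a minimum Steiner tree of `S` in `G`, i.e. a connected subgraph of `G`
of minimum total edge weight whose vertex set contains `S`.  Then
`d̃_B(T) ≤ 2α · d_G(ST)`. -/
theorem stmt13 {V N : Type*} [Fintype V] [Fintype N]
    (G : SimpleGraph V) (hG : G.Connected)
    (wG : Sym2 V → ℝ) (hw : ∀ e ∈ G.edgeSet, 0 < wG e)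
    (α : ℝ) (hα : 1 ≤ α)
    (B : SimpleGraph (V ⊕ N)) (dB : Sym2 (V ⊕ N) → ℝ)
    (hB : IsBipartiteEmulator G wG B dB α)
    (S : Set V) (hS : S.Nonempty)
    (T : (⊤ : SimpleGraph V).Subgraph) (hT : T.coe.IsTree) (hTv : T.verts = S)
    (hTmin : ∀ T' : (⊤ : SimpleGraph V).Subgraph, T'.coe.IsTree → T'.verts = S →
      subWeight (emuDist B dB) T ≤ subWeight (emuDist B dB) T')
    (ST : G.Subgraph) (hSTc : ST.Connected) (hSTv : S ⊆ ST.verts)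
    (hSTmin : ∀ H : G.Subgraph, H.Connected → S ⊆ H.verts →
      gsubWeight wG ST ≤ gsubWeight wG H) :
    subWeight (emuDist B dB) T ≤ 2 * α * gsubWeight wG ST := by
  obtain ⟨-, -, hd, -, -⟩ := id hB
  have hw' : ∀ e ∈ G.edgeSet, 0 ≤ wG e := fun e he => (hw e he).le
  have hα' : 0 ≤ α := zero_le_one.trans hα
  have hemu : ∀ e, 0 ≤ emuDist B dB e := fun e => Real.sInf_nonneg (nonneg_of_mem_emuDist_values hd e)
  obtain ⟨r, p, hp, hpw⟩ := exists_closed_walk_edgeWeight_le hw' ST hSTc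
  obtain ⟨H, hHc, hHv, a, -, q, hq⟩ := exists_connected_subWeight_add_le hw' hα' hemu
    (fun p => hB.emuDist_le hw' hα' p) p S hS (hSTv.trans hp)
  obtain ⟨T', hT'H, hT', hT'v⟩ := hHc.exists_isTree_le
  calc subWeight (emuDist B dB) T ≤ subWeight (emuDist B dB) T' :=
        hTmin T' hT' (hT'v.trans hHv)
    _ ≤ subWeight (emuDist B dB) H :=
        finsum_mem_le_finsum_mem_of_subset (Subgraph.edgeSet_mono hT'H) fun e _ => hemu e
    _ ≤ α * p.edgeWeight wG := by
        linarith [mul_nonneg hα' (q.edgeWeight_nonneg hw')]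
    _ ≤ α * (2 * gsubWeight wG ST) := mul_le_mul_of_nonneg_left hpw hα'
    _ = 2 * α * gsubWeight wG ST := by ring
end

section
/- Let B = (V(G) ⊎ N, E_B, d_B) be a bipartite emulator of a finite connected weighted graph G with stretch α ≥ 1, and let S ⊆ V(G) be nonempty. Let Γ_B(S) denote the set of neighbors in B of vertices of S, let T' = MST(B[S ∪ Γ_B(S)]) be a minimum-weight spanning tree of the subgraph of B induced by S ∪ Γ_B(S), let ℒ_N be the set of leaves of T' that belong to N, and let T be the tree obtained from T' by deleting the vertices of ℒ_N. Let T_MST = MST(G̃[S]) be a minimum-weight spanning tree of the complete graph G̃ restricted to S. Then d_B(T) ≤ 2 · d̃_B(T_MST). -/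
open SimpleGraph

open Classical in
/-- The weight of the pair `{v, x}` in `B`, extended by zero to non-edges. -/
noncomputable def crossWeight {V N : Type*} (B : SimpleGraph (V ⊕ N))
    (dB : Sym2 (V ⊕ N) → ℝ) (x : N) (v : V) : ℝ :=
  if B.Adj (Sum.inl v) (Sum.inr x) then dB s(Sum.inl v, Sum.inr x) else 0

lemma crossWeight_of_adj {V N : Type*} {B : SimpleGraph (V ⊕ N)}
    {dB : Sym2 (V ⊕ N) → ℝ} {x : N} {v : V} (h : B.Adj (Sum.inl v) (Sum.inr x)) :
    crossWeight B dB x v = dB s(Sum.inl v, Sum.inr x) := by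
  simp [crossWeight, h]

lemma crossWeight_nonneg {V N : Type*} {B : SimpleGraph (V ⊕ N)}
    {dB : Sym2 (V ⊕ N) → ℝ} (h : ∀ e ∈ B.edgeSet, 0 ≤ dB e) (x : N) (v : V) :
    0 ≤ crossWeight B dB x v := by
  unfold crossWeight
  split_ifs with hadj
  · exact h _ hadj
  · exact le_rfl

open Classical in
lemma gsubWeight_eq_sum {V N : Type*} [Fintype V] [Fintype N] {B : SimpleGraph (V ⊕ N)}
    (hV : ∀ u v : V, ¬ B.Adj (Sum.inl u) (Sum.inl v))
    (hN : ∀ x y : N, ¬ B.Adj (Sum.inr x) (Sum.inr y))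
    (dB : Sym2 (V ⊕ N) → ℝ) (H : B.Subgraph) :
    gsubWeight dB H = ∑ x : N, ∑ v : V,
      if H.Adj (Sum.inl v) (Sum.inr x) then crossWeight B dB x v else 0 := by
  let f : N × V → Sym2 (V ⊕ N) := fun q => s(Sum.inl q.2, Sum.inr q.1)
  have hf : Function.Injective f := by
    rintro ⟨x, v⟩ ⟨y, w⟩ h
    simpa [f, and_comm] using h
  have himg : H.edgeSet = f '' {q | H.Adj (Sum.inl q.2) (Sum.inr q.1)} := by
    ext e
    induction e with
    | h a b =>
      constructor
      · intro h
        have h : H.Adj a b := h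
        rcases a with u | x <;> rcases b with v | y
        · exact (hV _ _ h.adj_sub).elim
        · exact ⟨(y, u), h, rfl⟩
        · exact ⟨(x, v), h.symm, Sym2.eq_swap⟩
        · exact (hN _ _ h.adj_sub).elim
      · rintro ⟨q, hq, he⟩
        rw [← he]
        exact hq
  unfold gsubWeight
  rw [himg, finsum_mem_image hf.injOn, ← Fintype.sum_prod_type',
    finsum_mem_eq_finite_toFinset_sum _ (Set.toFinite _), ← Finset.sum_filter]
  refine Finset.sum_congr (by ext; simp) ?_
  intro q hq
  have hq' : H.Adj (Sum.inl q.2) (Sum.inr q.1) := by simpa using hq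
  exact (crossWeight_of_adj hq'.adj_sub).symm

/-- The weight `emuDist` of a pair is attained at an auxiliary vertex. -/
lemma exists_emuDist_eq {V N : Type*} [Finite N] {B : SimpleGraph (V ⊕ N)}
    (dB : Sym2 (V ⊕ N) → ℝ) {u v : V}
    (h : ∃ x : N, B.Adj (Sum.inl u) (Sum.inr x) ∧ B.Adj (Sum.inr x) (Sum.inl v)) :
    ∃ x : N, B.Adj (Sum.inl u) (Sum.inr x) ∧ B.Adj (Sum.inl v) (Sum.inr x) ∧
      emuDist B dB s(u, v) = crossWeight B dB x u + crossWeight B dB x v := by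
  have key : {r | ∃ (u' v' : V) (x : N), s(u, v) = s(u', v') ∧
      B.Adj (Sum.inl u') (Sum.inr x) ∧ B.Adj (Sum.inr x) (Sum.inl v') ∧
      r = dB s(Sum.inl u', Sum.inr x) + dB s(Sum.inr x, Sum.inl v')} =
      (fun x => crossWeight B dB x u + crossWeight B dB x v) ''
        {x | B.Adj (Sum.inl u) (Sum.inr x) ∧ B.Adj (Sum.inl v) (Sum.inr x)} := by
    ext r
    constructor
    · rintro ⟨u', v', x, he, h1, h2, rfl⟩
      rw [Sym2.eq_swap (a := Sum.inr x), ← crossWeight_of_adj (dB := dB) h1,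
        ← crossWeight_of_adj (dB := dB) h2.symm]
      rcases Sym2.eq_iff.1 he with ⟨rfl, rfl⟩ | ⟨rfl, rfl⟩
      · exact ⟨x, ⟨h1, h2.symm⟩, rfl⟩
      · exact ⟨x, ⟨h2.symm, h1⟩, add_comm _ _⟩
    · rintro ⟨x, ⟨h1, h2⟩, rfl⟩
      refine ⟨u, v, x, rfl, h1, h2.symm, ?_⟩
      rw [Sym2.eq_swap (a := Sum.inr x), ← crossWeight_of_adj (dB := dB) h1,
        ← crossWeight_of_adj (dB := dB) h2]
  obtain ⟨x, h1, h2⟩ := h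
  have hne : ((fun x => crossWeight B dB x u + crossWeight B dB x v) ''
        {x | B.Adj (Sum.inl u) (Sum.inr x) ∧ B.Adj (Sum.inl v) (Sum.inr x)}).Nonempty :=
    ⟨_, x, ⟨h1, h2.symm⟩, rfl⟩
  obtain ⟨y, ⟨hy1, hy2⟩, hy⟩ := hne.csInf_mem (Set.toFinite _)
  refine ⟨y, hy1, hy2, ?_⟩
  unfold emuDist
  rw [key]
  exact hy.symm

/-- A finite connected subgraph contains a spanning tree, as a subgraph of the ambient graph. -/
lemma SimpleGraph.Subgraph.exists_isTree_coe_le {α : Type*} [Finite α] {G : SimpleGraph α}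
    (H : G.Subgraph) (hH : H.coe.Connected) :
    ∃ T ≤ H, T.coe.IsTree ∧ T.verts = H.verts := by
  obtain ⟨T, hTH, hT⟩ := hH.exists_isTree_le
  refine ⟨⟨H.verts, fun a b => ∃ (ha : a ∈ H.verts) (hb : b ∈ H.verts), T.Adj ⟨a, ha⟩ ⟨b, hb⟩,
    ?_, ?_, ?_⟩, ⟨subset_rfl, ?_⟩, ?_, rfl⟩
  · rintro a b ⟨ha, hb, h⟩
    exact H.adj_sub (hTH h)
  · rintro a b ⟨ha, _⟩
    exact ha
  · exact ⟨fun a b ⟨ha, hb, h⟩ => ⟨hb, ha, h.symm⟩⟩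
  · rintro a b ⟨ha, hb, h⟩
    exact hTH h
  · convert hT
    ext a b
    exact ⟨fun ⟨_, _, h⟩ => h, fun h => ⟨a.2, b.2, h⟩⟩

open Classical in
/-- If every nonnegative term is at least `c` on a nonempty set `P`, the sum over `P` is at least `c`. -/
lemma le_sum_ite {V : Type*} [Fintype V] {P : V → Prop} {f : V → ℝ} {c : ℝ}
    (h0 : ∀ v, 0 ≤ f v) (hc : ∀ v, P v → c ≤ f v) {u : V} (hu : P u) :
    c ≤ ∑ v, if P v then f v else 0 := by
  have := Finset.single_le_sum (f := fun v => if P v then f v else 0)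
    (fun v _ => by split_ifs <;> simp [h0]) (Finset.mem_univ u)
  simp only [hu, if_true] at this
  exact (hc u hu).trans this

open Classical in
/-- If every nonnegative term is at least `c` on a set `P` with two elements, the sum over `P`
is at least `2 * c`. -/
lemma two_mul_le_sum_ite {V : Type*} [Fintype V] {P : V → Prop} {f : V → ℝ} {c : ℝ}
    (h0 : ∀ v, 0 ≤ f v) (hc : ∀ v, P v → c ≤ f v) {u w : V} (hu : P u) (hw : P w)
    (huw : u ≠ w) :
    2 * c ≤ ∑ v, if P v then f v else 0 := by
  have := Finset.sum_le_sum_of_subset_of_nonneg (f := fun v => if P v then f v else 0)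
    (Finset.subset_univ {u, w}) (fun v _ _ => by split_ifs <;> simp [h0])
  rw [Finset.sum_pair huw] at this
  simp only [hu, hw, if_true] at this
  linarith [hc u hu, hc w hw]

/-- The subgraph of `B` on `A` joining each auxiliary vertex `x ∈ A` to `σ x` and, for each edge
`e` of `M`, both ends of `e` to `ξ e`. -/
def joinSubgraph {V N : Type*} (B : SimpleGraph (V ⊕ N)) (A : Set (V ⊕ N))
    (M : (⊤ : SimpleGraph V).Subgraph) (σ : N → V) (ξ : Sym2 V → N) : B.Subgraph where
  verts := A
  Adj a b := a ∈ A ∧ b ∈ A ∧ B.Adj a b ∧ ∃ (x : N) (v : V),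
    s(a, b) = s(Sum.inl v, Sum.inr x) ∧ (v = σ x ∨ ∃ e ∈ M.edgeSet, v ∈ e ∧ x = ξ e)
  adj_sub h := h.2.2.1
  edge_vert h := h.1
  symm := ⟨fun a b ⟨ha, hb, hab, x, v, he, h⟩ =>
    ⟨hb, ha, hab.symm, x, v, by rw [Sym2.eq_swap, he], h⟩⟩

lemma joinSubgraph_adj_inl_inr {V N : Type*} {B : SimpleGraph (V ⊕ N)} {A : Set (V ⊕ N)}
    {M : (⊤ : SimpleGraph V).Subgraph} {σ : N → V} {ξ : Sym2 V → N} {x : N} {v : V} :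
    (joinSubgraph B A M σ ξ).Adj (Sum.inl v) (Sum.inr x) ↔
      Sum.inl v ∈ A ∧ Sum.inr x ∈ A ∧ B.Adj (Sum.inl v) (Sum.inr x) ∧
        (v = σ x ∨ ∃ e ∈ M.edgeSet, v ∈ e ∧ x = ξ e) := by
  simp only [joinSubgraph]
  refine and_congr_right fun _ => and_congr_right fun _ => and_congr_right fun _ => ?_
  constructor
  · rintro ⟨y, w, he, h⟩
    simp only [Sym2.eq_iff, Sum.inl.injEq, Sum.inr.injEq, reduceCtorEq, and_self, or_false] at he
    obtain ⟨rfl, rfl⟩ := he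
    exact h
  · exact fun h => ⟨x, v, rfl, h⟩

lemma joinSubgraph_connected {V N : Type*} {B : SimpleGraph (V ⊕ N)} {A : Set (V ⊕ N)}
    {M : (⊤ : SimpleGraph V).Subgraph} {σ : N → V} {ξ : Sym2 V → N}
    (hM : M.coe.Connected) (hAM : ∀ v, Sum.inl v ∈ A ↔ v ∈ M.verts)
    (hσ : ∀ x, Sum.inr x ∈ A → σ x ∈ M.verts ∧ B.Adj (Sum.inl (σ x)) (Sum.inr x))
    (hξ : ∀ e ∈ M.edgeSet, Sum.inr (ξ e) ∈ A ∧ ∀ v ∈ e, B.Adj (Sum.inl v) (Sum.inr (ξ e))) :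
    (joinSubgraph B A M σ ξ).coe.Connected := by
  set H := joinSubgraph B A M σ ξ
  have hstep : ∀ u v : M.verts, M.coe.Adj u v →
      H.coe.Reachable ⟨Sum.inl u.1, (hAM _).2 u.2⟩ ⟨Sum.inl v.1, (hAM _).2 v.2⟩ := by
    intro u v huv
    have he : s(u.1, v.1) ∈ M.edgeSet := huv
    obtain ⟨hA, hadj⟩ := hξ _ he
    have h1 : H.coe.Adj ⟨Sum.inl u.1, (hAM _).2 u.2⟩ ⟨Sum.inr (ξ s(u.1, v.1)), hA⟩ :=
      joinSubgraph_adj_inl_inr.2 ⟨(hAM _).2 u.2, hA, hadj _ (Sym2.mem_mk_left _ _),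
        Or.inr ⟨_, he, Sym2.mem_mk_left _ _, rfl⟩⟩
    have h2 : H.coe.Adj ⟨Sum.inl v.1, (hAM _).2 v.2⟩ ⟨Sum.inr (ξ s(u.1, v.1)), hA⟩ :=
      joinSubgraph_adj_inl_inr.2 ⟨(hAM _).2 v.2, hA, hadj _ (Sym2.mem_mk_right _ _),
        Or.inr ⟨_, he, Sym2.mem_mk_right _ _, rfl⟩⟩
    exact h1.reachable.trans h2.symm.reachable
  have hwalk : ∀ u v : M.verts,
      H.coe.Reachable ⟨Sum.inl u.1, (hAM _).2 u.2⟩ ⟨Sum.inl v.1, (hAM _).2 v.2⟩ := by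
    intro u v
    obtain ⟨p⟩ := hM.preconnected u v
    induction p with
    | nil => exact Reachable.refl _
    | cons h _ ih => exact (hstep _ _ h).trans ih
  have hinl : ∀ a : H.verts, ∃ u : M.verts,
      H.coe.Reachable a ⟨Sum.inl u.1, (hAM _).2 u.2⟩ := by
    rintro ⟨v | x, ha⟩
    · exact ⟨⟨v, (hAM _).1 ha⟩, Reachable.refl _⟩
    · obtain ⟨hs, hadj⟩ := hσ x ha
      have h1 : H.coe.Adj ⟨Sum.inl (σ x), (hAM _).2 hs⟩ ⟨Sum.inr x, ha⟩ :=
        joinSubgraph_adj_inl_inr.2 ⟨(hAM _).2 hs, ha, hadj, Or.inl rfl⟩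
      exact ⟨⟨σ x, hs⟩, h1.symm.reachable⟩
  obtain ⟨u₀⟩ := hM.nonempty
  have : Nonempty H.verts := ⟨⟨Sum.inl u₀.1, (hAM _).2 u₀.2⟩⟩
  refine ⟨fun a b => ?_⟩
  obtain ⟨u, hu⟩ := hinl a
  obtain ⟨v, hv⟩ := hinl b
  exact (hu.trans (hwalk u v)).trans hv.symm

open Classical in
lemma gsubWeight_joinSubgraph_le {V N : Type*} [Fintype V] [Fintype N]
    {B : SimpleGraph (V ⊕ N)}
    (hV : ∀ u v : V, ¬ B.Adj (Sum.inl u) (Sum.inl v))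
    (hN : ∀ x y : N, ¬ B.Adj (Sum.inr x) (Sum.inr y))
    {dB : Sym2 (V ⊕ N) → ℝ} (h0 : ∀ e ∈ B.edgeSet, 0 ≤ dB e) (A : Set (V ⊕ N))
    (M : (⊤ : SimpleGraph V).Subgraph) (σ : N → V) (ξ : Sym2 V → N)
    (hξ : ∀ u v : V, emuDist B dB s(u, v) =
      crossWeight B dB (ξ s(u, v)) u + crossWeight B dB (ξ s(u, v)) v) :
    gsubWeight dB (joinSubgraph B A M σ ξ) ≤
      (∑ x : N, if Sum.inr x ∈ A then crossWeight B dB x (σ x) else 0) +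
        subWeight (emuDist B dB) M := by
  have hD := crossWeight_nonneg h0
  have hM : subWeight (emuDist B dB) M = ∑ e ∈ M.edgeSet.toFinset, ∑ x : N, ∑ v : V,
      if v ∈ e ∧ x = ξ e then crossWeight B dB x v else 0 := by
    unfold subWeight
    rw [finsum_mem_eq_toFinset_sum]
    refine Finset.sum_congr rfl fun e he => ?_
    induction e with
    | h u w =>
      have huw : u ≠ w := (show M.Adj u w by simpa using he).ne
      rw [Finset.sum_eq_single (ξ s(u, w)) (fun x _ hx => by simp [hx]) (by simp), hξ]
      simp only [and_true]
      rw [← Finset.sum_filter, show Finset.univ.filter (fun v => v ∈ s(u, w)) = {u, w} by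
        ext; simp, Finset.sum_pair huw]
  have hswap : subWeight (emuDist B dB) M = ∑ x : N, ∑ v : V, ∑ e ∈ M.edgeSet.toFinset,
      if v ∈ e ∧ x = ξ e then crossWeight B dB x v else 0 := by
    rw [hM, Finset.sum_comm]
    exact Finset.sum_congr rfl fun x _ => Finset.sum_comm
  rw [gsubWeight_eq_sum hV hN, hswap, ← Finset.sum_add_distrib]
  refine Finset.sum_le_sum fun x _ => ?_
  have hσ : (if Sum.inr x ∈ A then crossWeight B dB x (σ x) else 0) =
      ∑ v : V, if v = σ x then (if Sum.inr x ∈ A then crossWeight B dB x v else 0) else 0 := by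
    simp
  rw [hσ, ← Finset.sum_add_distrib]
  refine Finset.sum_le_sum fun v _ => ?_
  have hn1 : 0 ≤ if v = σ x then (if Sum.inr x ∈ A then crossWeight B dB x v else 0) else 0 := by
    split_ifs <;> simp [hD]
  have hn2 : ∀ e ∈ M.edgeSet.toFinset,
      0 ≤ if v ∈ e ∧ x = ξ e then crossWeight B dB x v else 0 := by
    intro e _
    split_ifs <;> simp [hD]
  have hn3 := Finset.sum_nonneg hn2
  by_cases hadj : (joinSubgraph B A M σ ξ).Adj (Sum.inl v) (Sum.inr x)
  · rw [if_pos hadj]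
    obtain ⟨-, hxA, -, hv | ⟨e, he, hve, hxe⟩⟩ := joinSubgraph_adj_inl_inr.1 hadj
    · rw [if_pos hv, if_pos hxA]
      linarith
    · have := Finset.single_le_sum hn2 (Set.mem_toFinset.2 he)
      rw [if_pos ⟨hve, hxe⟩] at this
      linarith
  · rw [if_neg hadj]
    linarith

lemma exists_min_crossWeight {V N : Type*} [Finite V] (B : SimpleGraph (V ⊕ N))
    (dB : Sym2 (V ⊕ N) → ℝ) (S : Set V) [Nonempty V] (x : N) :
    ∃ s : V, (∃ u ∈ S, B.Adj (Sum.inl u) (Sum.inr x)) →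
      (s ∈ S ∧ B.Adj (Sum.inl s) (Sum.inr x)) ∧
        ∀ u ∈ S, B.Adj (Sum.inl u) (Sum.inr x) →
          crossWeight B dB x s ≤ crossWeight B dB x u := by
  by_cases h : ∃ u ∈ S, B.Adj (Sum.inl u) (Sum.inr x)
  · obtain ⟨s, hs, hmin⟩ := Set.exists_min_image {u | u ∈ S ∧ B.Adj (Sum.inl u) (Sum.inr x)}
      (crossWeight B dB x) (Set.toFinite _) h
    exact ⟨s, fun _ => ⟨hs, fun u hu hux => hmin u ⟨hu, hux⟩⟩⟩
  · exact ⟨Classical.arbitrary V, fun h' => (h h').elim⟩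

/-- Let `B = (V(G) ⊎ N, E_B, d_B)` be a bipartite emulator of a finite connected
weighted graph `G` with stretch `α ≥ 1` and let `S ⊆ V(G)` be nonempty.  Let
`A = S ∪ Γ_B(S)` (terminals together with their neighbors in `B`), let `T'` be a
minimum-weight spanning tree of the subgraph of `B` induced by `A`, let `L` be the
set of leaves of `T'` lying in `N`, and let `T = T'.deleteVerts L` be the tree
obtained from `T'` by deleting these leaves.  Let `TM = MST(G̃[S])` be a
minimum-weight spanning tree of the complete graph `G̃` (with weights `d̃_B`)
restricted to `S`.  Then `d_B(T) ≤ 2 · d̃_B(TM)`. -/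
theorem stmt14 {V N : Type*} [Fintype V] [Fintype N]
    (G : SimpleGraph V) (hG : G.Connected)
    (wG : Sym2 V → ℝ) (hw : ∀ e ∈ G.edgeSet, 0 < wG e)
    (α : ℝ) (hα : 1 ≤ α)
    (B : SimpleGraph (V ⊕ N)) (dB : Sym2 (V ⊕ N) → ℝ)
    (hB : IsBipartiteEmulator G wG B dB α)
    (S : Set V) (hS : S.Nonempty)
    (A : Set (V ⊕ N))
    (hA : A = Sum.inl '' S ∪ {b : V ⊕ N | ∃ u ∈ S, B.Adj (Sum.inl u) b})
    (T' : B.Subgraph) (hT' : T'.coe.IsTree) (hT'v : T'.verts = A)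
    (hT'min : ∀ T'' : B.Subgraph, T''.coe.IsTree → T''.verts = A →
      gsubWeight dB T' ≤ gsubWeight dB T'')
    (L : Set (V ⊕ N))
    (hL : L = {x : V ⊕ N | (∃ y : N, x = Sum.inr y) ∧ x ∈ T'.verts ∧
      Nat.card (T'.neighborSet x) = 1})
    (TM : (⊤ : SimpleGraph V).Subgraph) (hTM : TM.coe.IsTree) (hTMv : TM.verts = S)
    (hTMmin : ∀ T'' : (⊤ : SimpleGraph V).Subgraph, T''.coe.IsTree → T''.verts = S →
      subWeight (emuDist B dB) TM ≤ subWeight (emuDist B dB) T'') :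
    gsubWeight dB (T'.deleteVerts L) ≤ 2 * subWeight (emuDist B dB) TM := by
  classical
  obtain ⟨hV, hN, h0, -, hem⟩ := hB
  have hD := crossWeight_nonneg h0
  have : Nonempty V := ⟨hS.some⟩
  have hinl : ∀ v, Sum.inl v ∈ A ↔ v ∈ S := by
    intro v
    simp [hA, hV]
  have hinr : ∀ x, Sum.inr x ∈ A ↔ ∃ u ∈ S, B.Adj (Sum.inl u) (Sum.inr x) := by
    intro x
    simp [hA]
  choose σ hσ using exists_min_crossWeight B dB S
  have hξ' : ∀ e : Sym2 V, ∃ x : N, (∀ v ∈ e, B.Adj (Sum.inl v) (Sum.inr x)) ∧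
      ∀ u v, e = s(u, v) →
        emuDist B dB s(u, v) = crossWeight B dB x u + crossWeight B dB x v := by
    intro e
    induction e with
    | h u v =>
      obtain ⟨x, h1, h2, h3⟩ := exists_emuDist_eq dB
        (let ⟨x, h1, h2, _⟩ := hem u v; ⟨x, h1, h2⟩)
      refine ⟨x, ?_, ?_⟩
      · intro w hw
        rcases Sym2.mem_iff.1 hw with rfl | rfl <;> assumption
      · intro u' v' he
        rw [← he, h3]
        rcases Sym2.eq_iff.1 he with ⟨rfl, rfl⟩ | ⟨rfl, rfl⟩
        · rfl
        · exact add_comm _ _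
  choose ξ hξadj hξ using hξ'
  set H := joinSubgraph B A TM σ ξ with hH
  have hHconn : H.coe.Connected := by
    refine joinSubgraph_connected hTM.connected (by simpa [hTMv] using hinl) ?_ ?_
    · intro x hx
      rw [hTMv]
      exact (hσ x ((hinr x).1 hx)).1
    · intro e he
      refine ⟨?_, hξadj e⟩
      induction e with
      | h u v =>
        have hu : u ∈ TM.verts := TM.edge_vert he
        exact (hinr _).2 ⟨u, hTMv ▸ hu, hξadj _ _ (Sym2.mem_mk_left _ _)⟩
  obtain ⟨T'', hle, hT'', hT''v⟩ := H.exists_isTree_coe_le hHconn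
  have hmono : gsubWeight dB T'' ≤ gsubWeight dB H := by
    rw [gsubWeight_eq_sum hV hN, gsubWeight_eq_sum hV hN]
    refine Finset.sum_le_sum fun x _ => Finset.sum_le_sum fun v _ => ?_
    by_cases h : T''.Adj (Sum.inl v) (Sum.inr x)
    · rw [if_pos h, if_pos (hle.2 h)]
    · rw [if_neg h]
      split_ifs <;> simp [hD]
  have hbound := ((hT'min T'' hT'' hT''v).trans hmono).trans
    (gsubWeight_joinSubgraph_le hV hN h0 A TM σ ξ fun u v => hξ _ u v rfl)
  have hstar : ∀ x : N,
      (∑ v : V, if (T'.deleteVerts L).Adj (Sum.inl v) (Sum.inr x) then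
        crossWeight B dB x v else 0) ≤
      2 * ((∑ v : V, if T'.Adj (Sum.inl v) (Sum.inr x) then crossWeight B dB x v else 0) -
        if Sum.inr x ∈ A then crossWeight B dB x (σ x) else 0) := by
    intro x
    by_cases hx : Sum.inr x ∈ A
    swap
    · have hno : ∀ v, ¬ T'.Adj (Sum.inl v) (Sum.inr x) := fun v h =>
        hx (hT'v ▸ T'.edge_vert h.symm)
      simp [hno, hx]
    rw [if_pos hx]
    have hmin : ∀ v, T'.Adj (Sum.inl v) (Sum.inr x) →
        crossWeight B dB x (σ x) ≤ crossWeight B dB x v := fun v h =>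
      (hσ x ((hinr x).1 hx)).2 v ((hinl v).1 (hT'v ▸ T'.edge_vert h)) h.adj_sub
    obtain ⟨u, hu⟩ : ∃ u, T'.Adj (Sum.inl u) (Sum.inr x) := by
      obtain ⟨s, hs⟩ := hS
      have hsA : Sum.inl s ∈ T'.verts := hT'v ▸ (hinl s).2 hs
      have hxA : Sum.inr x ∈ T'.verts := hT'v ▸ hx
      have : Nontrivial T'.verts :=
        ⟨⟨Sum.inl s, hsA⟩, ⟨Sum.inr x, hxA⟩, by simp⟩
      obtain ⟨⟨b, hb⟩, hadj⟩ :=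
        hT'.connected.preconnected.exists_adj_of_nontrivial ⟨Sum.inr x, hxA⟩
      have hadj : T'.Adj (Sum.inr x) b := hadj
      rcases b with u | y
      · exact ⟨u, hadj.symm⟩
      · exact (hN _ _ hadj.adj_sub).elim
    by_cases hxL : Sum.inr x ∈ L
    · have hno : ∀ v, ¬ (T'.deleteVerts L).Adj (Sum.inl v) (Sum.inr x) := by
        intro v h
        simp [hxL] at h
      have := le_sum_ite (P := fun v => T'.Adj (Sum.inl v) (Sum.inr x)) (hD x) hmin hu
      simp only [hno, if_false, Finset.sum_const_zero]
      linarith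
    · obtain ⟨w, hw, huw⟩ : ∃ w, T'.Adj (Sum.inl w) (Sum.inr x) ∧ u ≠ w := by
        by_contra! hcon
        refine hxL ?_
        rw [hL]
        refine ⟨⟨x, rfl⟩, hT'v ▸ hx, ?_⟩
        rw [Nat.card_eq_one_iff_exists]
        refine ⟨⟨Sum.inl u, hu.symm⟩, ?_⟩
        rintro ⟨w | y, hb⟩
        · have hb : T'.Adj (Sum.inr x) (Sum.inl w) := hb
          simp [hcon w hb.symm]
        · have hb : T'.Adj (Sum.inr x) (Sum.inr y) := hb
          exact (hN _ _ hb.adj_sub).elim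
      have h2 := two_mul_le_sum_ite (P := fun v => T'.Adj (Sum.inl v) (Sum.inr x))
        (hD x) hmin hu hw huw
      have h3 : (∑ v : V, if (T'.deleteVerts L).Adj (Sum.inl v) (Sum.inr x) then
          crossWeight B dB x v else 0) ≤
          ∑ v : V, if T'.Adj (Sum.inl v) (Sum.inr x) then crossWeight B dB x v else 0 := by
        refine Finset.sum_le_sum fun v _ => ?_
        by_cases h : (T'.deleteVerts L).Adj (Sum.inl v) (Sum.inr x)
        · rw [if_pos h, if_pos (Subgraph.deleteVerts_le.2 h)]
        · rw [if_neg h]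
          split_ifs <;> simp [hD]
      linarith
  have hsum := Finset.sum_le_sum fun x (_ : x ∈ Finset.univ) => hstar x
  have hdel : gsubWeight dB (T'.deleteVerts L) = ∑ x : N, ∑ v : V,
      if (T'.deleteVerts L).Adj (Sum.inl v) (Sum.inr x) then crossWeight B dB x v else 0 := by
    convert gsubWeight_eq_sum hV hN dB (T'.deleteVerts L)
  rw [← hdel, ← Finset.mul_sum, Finset.sum_sub_distrib, ← gsubWeight_eq_sum hV hN] at hsum
  linarith
end

section
/- Let G = (V, E, w) be a finite connected graph with positive edge weights, let 0 < ε ≤ 1, let L > 0, and let Q be a shortest path in G of total weight at most L. Then there exists a set P of vertices of Q with |P| ≤ 2(⌈4/ε⌉ + 1) such that the following holds: for all u, v ∈ V, if some shortest path between u and v in G shares a vertex with Q and δ_G(u,v) ∈ [L/2, L], then there exists p ∈ P with δ_G(u,v) ≤ δ_G(u,p) + δ_G(p,v) ≤ (1+ε)·δ_G(u,v). -/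
open SimpleGraph

namespace SimpleGraph

variable {V : Type*} {G : SimpleGraph V} {w : Sym2 V → ℝ}

lemma Walk.sum_map_edges_nonneg (hw : ∀ e ∈ G.edgeSet, 0 < w e) {u v : V} (p : G.Walk u v) :
    0 ≤ (p.edges.map w).sum := by
  refine List.sum_nonneg fun x hx ↦ ?_
  obtain ⟨e, he, rfl⟩ := List.mem_map.1 hx
  exact (hw e (p.edges_subset_edgeSet he)).le

lemma spDist_le_sum (hw : ∀ e ∈ G.edgeSet, 0 < w e) {u v : V} (p : G.Walk u v) :
    spDist G w u v ≤ (p.edges.map w).sum :=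
  csInf_le ⟨0, by rintro _ ⟨q, rfl⟩; exact q.sum_map_edges_nonneg hw⟩ ⟨p, rfl⟩

lemma le_spDist (hG : G.Connected) {u v : V} {r : ℝ}
    (h : ∀ p : G.Walk u v, r ≤ (p.edges.map w).sum) : r ≤ spDist G w u v := by
  obtain ⟨p⟩ := hG.preconnected u v
  refine le_csInf ⟨_, p, rfl⟩ ?_
  rintro _ ⟨q, rfl⟩
  exact h q

lemma spDist_nonneg (hG : G.Connected) (hw : ∀ e ∈ G.edgeSet, 0 < w e) (u v : V) :
    0 ≤ spDist G w u v :=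
  le_spDist hG fun p ↦ p.sum_map_edges_nonneg hw

lemma spDist_comm (u v : V) : spDist G w u v = spDist G w v u := by
  unfold spDist
  congr 1
  ext x
  constructor
  all_goals
    rintro ⟨p, rfl⟩
    exact ⟨p.reverse, by rw [Walk.edges_reverse, List.map_reverse, List.sum_reverse]⟩

lemma spDist_triangle (hG : G.Connected) (hw : ∀ e ∈ G.edgeSet, 0 < w e) (u x v : V) :
    spDist G w u v ≤ spDist G w u x + spDist G w x v := by
  rw [← sub_le_iff_le_add]
  refine le_spDist hG fun p ↦ ?_
  rw [sub_le_comm]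
  refine le_spDist hG fun q ↦ ?_
  have h := spDist_le_sum hw (p.append q)
  rw [Walk.edges_append, List.map_append, List.sum_append] at h
  linarith

/-- A vertex splits a shortest walk into two shortest walks. -/
lemma Walk.exists_split_of_sum_eq_spDist (hG : G.Connected) (hw : ∀ e ∈ G.edgeSet, 0 < w e)
    {u v x : V} {p : G.Walk u v} (hp : (p.edges.map w).sum = spDist G w u v)
    (hx : x ∈ p.support) :
    ∃ (q : G.Walk u x) (r : G.Walk x v), p = q.append r ∧
      (q.edges.map w).sum = spDist G w u x ∧ (r.edges.map w).sum = spDist G w x v ∧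
      spDist G w u x + spDist G w x v = spDist G w u v := by
  obtain ⟨q, r, rfl⟩ := Walk.mem_support_iff_exists_append.1 hx
  have hq := spDist_le_sum hw q
  have hr := spDist_le_sum hw r
  have ht := spDist_triangle hG hw u x v
  rw [Walk.edges_append, List.map_append, List.sum_append] at hp
  exact ⟨q, r, rfl, by linarith, by linarith, by linarith⟩

/-- Along a shortest walk, distances are differences of distances to the start. -/
lemma Walk.spDist_eq_abs_sub (hG : G.Connected) (hw : ∀ e ∈ G.edgeSet, 0 < w e)
    {a b x y : V} {p : G.Walk a b} (hp : (p.edges.map w).sum = spDist G w a b)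
    (hx : x ∈ p.support) (hy : y ∈ p.support) :
    spDist G w x y = |spDist G w a x - spDist G w a y| := by
  obtain ⟨-, -, -, -, -, hay⟩ := exists_split_of_sum_eq_spDist hG hw hp hy
  obtain ⟨q, r, rfl, hq, hr, hax⟩ := exists_split_of_sum_eq_spDist hG hw hp hx
  have h0 := spDist_nonneg hG hw x y
  rcases (Walk.mem_support_append_iff q r).1 hy with h | h
  · obtain ⟨-, -, -, -, -, h'⟩ := exists_split_of_sum_eq_spDist hG hw hq h
    rw [spDist_comm y x] at h'
    rw [abs_of_nonneg] <;> linarith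
  · obtain ⟨-, -, -, -, -, h'⟩ := exists_split_of_sum_eq_spDist hG hw hr h
    rw [abs_of_nonpos] <;> linarith

/-- A shortest walk of weight at most `n * c` is covered by `n + 1` balls of radius `c`
centred on it. -/
lemma Walk.exists_finset_spDist_le (hG : G.Connected) (hw : ∀ e ∈ G.edgeSet, 0 < w e)
    {a b : V} {p : G.Walk a b} (hp : (p.edges.map w).sum = spDist G w a b)
    {c : ℝ} (hc : 0 < c) {n : ℕ} (hn : (p.edges.map w).sum ≤ n * c) :
    ∃ P : Finset V, (∀ y ∈ P, y ∈ p.support) ∧ P.card ≤ n + 1 ∧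
      ∀ x ∈ p.support, ∃ y ∈ P, spDist G w x y ≤ c := by
  classical
  have hbucket (k : ℕ) : ∃ y ∈ p.support,
      (∃ x ∈ p.support, ⌊spDist G w a x / c⌋₊ = k) → ⌊spDist G w a y / c⌋₊ = k := by
    by_cases h : ∃ x ∈ p.support, ⌊spDist G w a x / c⌋₊ = k
    · obtain ⟨y, hy, hk⟩ := h
      exact ⟨y, hy, fun _ ↦ hk⟩
    · exact ⟨a, p.start_mem_support, fun h' ↦ absurd h' h⟩
  choose g hg hgk using hbucket
  refine ⟨(Finset.range (n + 1)).image g, ?_, ?_, fun x hx ↦ ?_⟩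
  · simp only [Finset.mem_image]
    rintro _ ⟨k, -, rfl⟩
    exact hg k
  · simpa using Finset.card_image_le (s := Finset.range (n + 1)) (f := g)
  · obtain ⟨-, -, -, -, -, hax⟩ := exists_split_of_sum_eq_spDist hG hw hp hx
    have hxb := spDist_nonneg hG hw x b
    have hle : spDist G w a x / c ≤ n := by
      rw [div_le_iff₀ hc]
      linarith
    refine ⟨g ⌊spDist G w a x / c⌋₊, Finset.mem_image_of_mem _ <| Finset.mem_range.2 <|
      Nat.lt_succ_of_le <| Nat.floor_le_of_le hle, ?_⟩
    have hk := hgk _ ⟨x, hx, rfl⟩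
    rw [spDist_eq_abs_sub hG hw hp hx (hg _)]
    set y := g ⌊spDist G w a x / c⌋₊
    have hx1 := Nat.floor_le (div_nonneg (spDist_nonneg hG hw a x) hc.le)
    have hx2 := Nat.lt_floor_add_one (spDist G w a x / c)
    have hy1 := Nat.floor_le (div_nonneg (spDist_nonneg hG hw a y) hc.le)
    have hy2 := Nat.lt_floor_add_one (spDist G w a y / c)
    rw [hk] at hy1 hy2
    have h : |spDist G w a x / c - spDist G w a y / c| ≤ 1 :=
      abs_le.2 ⟨by linarith, by linarith⟩
    rwa [← sub_div, abs_div, abs_of_pos hc, div_le_one hc] at h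

end SimpleGraph

/-- Let `G = (V, E, w)` be a finite connected graph with positive edge weights, let
`0 < ε ≤ 1`, `L > 0`, and let `Q` be a shortest path in `G` of total weight at most
`L`.  Then there is a set `P` of vertices of `Q` with `|P| ≤ 2(⌈4/ε⌉ + 1)` such
that: for all `u, v ∈ V`, if some shortest path between `u` and `v` shares a vertex
with `Q` and `δ_G(u,v) ∈ [L/2, L]`, then there is `p ∈ P` with
`δ_G(u,v) ≤ δ_G(u,p) + δ_G(p,v) ≤ (1+ε)·δ_G(u,v)`. -/
theorem stmt15 {V : Type*} [Fintype V]
    (G : SimpleGraph V) (hG : G.Connected)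
    (w : Sym2 V → ℝ) (hw : ∀ e ∈ G.edgeSet, 0 < w e)
    (ε : ℝ) (hε0 : 0 < ε) (hε1 : ε ≤ 1)
    (L : ℝ) (hL : 0 < L)
    {a b : V} (Q : G.Walk a b) (hQpath : Q.IsPath)
    (hQsp : (Q.edges.map w).sum = spDist G w a b)
    (hQlen : (Q.edges.map w).sum ≤ L) :
    ∃ P : Finset V, (∀ p ∈ P, p ∈ Q.support) ∧
      P.card ≤ 2 * (⌈(4 : ℝ) / ε⌉₊ + 1) ∧
      ∀ u v : V,
        (∃ p : G.Walk u v, p.IsPath ∧ (p.edges.map w).sum = spDist G w u v ∧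
          ∃ x, x ∈ p.support ∧ x ∈ Q.support) →
        L / 2 ≤ spDist G w u v → spDist G w u v ≤ L →
        ∃ p ∈ P, spDist G w u v ≤ spDist G w u p + spDist G w p v ∧
          spDist G w u p + spDist G w p v ≤ (1 + ε) * spDist G w u v := by
  have hc : 0 < ε * L / 4 := by positivity
  have hn : (Q.edges.map w).sum ≤ ⌈(4 : ℝ) / ε⌉₊ * (ε * L / 4) := by
    refine hQlen.trans ?_
    calc L = 4 / ε * (ε * L / 4) := by field_simp
      _ ≤ _ := by gcongr; exact Nat.le_ceil _
  obtain ⟨P, hPQ, hPcard, hP⟩ := Walk.exists_finset_spDist_le hG hw hQsp hc hn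
  refine ⟨P, hPQ, by omega, ?_⟩
  rintro u v ⟨p, -, hp, x, hxp, hxQ⟩ hL2 -
  obtain ⟨y, hy, hxy⟩ := hP x hxQ
  refine ⟨y, hy, spDist_triangle hG hw u y v, ?_⟩
  obtain ⟨-, -, -, -, -, hx⟩ := Walk.exists_split_of_sum_eq_spDist hG hw hp hxp
  have h1 := spDist_triangle hG hw u x y
  have h2 := spDist_triangle hG hw y x v
  rw [spDist_comm y x] at h2
  have h3 := mul_le_mul_of_nonneg_left hL2 hε0.le
  linarith
end
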